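/- Let b > 0. The third Neumann eigenvalue λ₃^N of the cylindrical strip C(b) is Courant sharp (i.e. some real eigenfunction associated with λ₃^N has exactly 3 nodal domains) if and only if b ≥ 1. -/

import Mathlib

open MeasureTheory Set Real Filter
open scoped ENNReal

noncomputable section

namespace SMP

/-! ## The cylinder `C(L,b) = (ℝ/Lℤ) × (0,b)`.

Functions on the cylinder are represented by functions on `ℝ × ℝ` that are
`L`-periodic in the first variable; open subsets of the cylinder are represented
by `L`-periodic open subsets of the open strip `ℝ × (0,b)`.  Integrals over the
cylinder are integrals over the fundamental rectangle `(0,L) × (0,b)`. -/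

/-- The fundamental rectangle `(0,L) × (0,b)`. -/
def rect (L b : ℝ) : Set (ℝ × ℝ) := Ioo 0 L ×ˢ Ioo 0 b

/-- The closed strip `ℝ × [0,b]`. -/
def stripC (b : ℝ) : Set (ℝ × ℝ) := univ ×ˢ Icc 0 b

/-- The open strip `ℝ × (0,b)`. -/
def stripO (b : ℝ) : Set (ℝ × ℝ) := univ ×ˢ Ioo 0 b

/-- The form domain (a dense subspace of the relevant Sobolev space): `L`-periodic
functions, `C¹` up to the boundary of the strip, vanishing on the set `T`
(the Dirichlet part of the boundary; `T = ∅` for the pure Neumann problem). -/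
def formDomain (L b : ℝ) (T : Set (ℝ × ℝ)) : Submodule ℝ ((ℝ × ℝ) → ℝ) where
  carrier := {u | (∀ p : ℝ × ℝ, u (p.1 + L, p.2) = u p) ∧
    ContDiffOn ℝ 1 u (stripC b) ∧ ∀ p ∈ T, u p = 0}
  zero_mem' := ⟨fun _ => rfl, contDiffOn_const, fun _ _ => rfl⟩
  add_mem' := by
    rintro u v ⟨hu1, hu2, hu3⟩ ⟨hv1, hv2, hv3⟩
    exact ⟨fun p => by simp [hu1 p, hv1 p], hu2.add hv2,
      fun p hp => by simp [hu3 p hp, hv3 p hp]⟩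
  smul_mem' := by
    rintro c u ⟨hu1, hu2, hu3⟩
    exact ⟨fun p => by simp [hu1 p], hu2.const_smul c,
      fun p hp => by simp [hu3 p hp]⟩

/-- The Dirichlet energy `∫_{C(L,b)} |∇u|²`. -/
def energyInt (L b : ℝ) (u : (ℝ × ℝ) → ℝ) : ℝ := ∫ p in rect L b, ‖fderiv ℝ u p‖ ^ 2

/-- The squared `L²` norm `∫_{C(L,b)} |u|²`. -/
def massInt (L b : ℝ) (u : (ℝ × ℝ) → ℝ) : ℝ := ∫ p in rect L b, (u p) ^ 2

/-- The Rayleigh quotient. -/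
def rayleigh (L b : ℝ) (u : (ℝ × ℝ) → ℝ) : ℝ := energyInt L b u / massInt L b u

/-- The `k`-th eigenvalue (`k ≥ 1`, counted with multiplicity) of the Laplacian on
`C(L,b)` with Dirichlet condition on `T` and Neumann condition on the rest of the
boundary, via the Courant–Fischer min–max formula over `k`-dimensional subspaces
of (a dense subspace of) the form domain. -/
def eigenvalue (L b : ℝ) (T : Set (ℝ × ℝ)) (k : ℕ) : ℝ :=
  sInf {Λ : ℝ | ∃ V : Submodule ℝ ((ℝ × ℝ) → ℝ), V ≤ formDomain L b T ∧
    Module.finrank ℝ V = k ∧ (∀ u ∈ V, u ≠ 0 → massInt L b u ≠ 0) ∧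
    ∀ u ∈ V, u ≠ 0 → rayleigh L b u ≤ Λ}

/-- `λ_k^N(C(L,b))`: pure Neumann boundary conditions. -/
def lamN (L b : ℝ) (k : ℕ) : ℝ := eigenvalue L b ∅ k

/-- `λ_k^{DN}(C(L,b))`: Dirichlet at `y = 0`, Neumann at `y = b`. -/
def lamDN (L b : ℝ) (k : ℕ) : ℝ := eigenvalue L b ((univ : Set ℝ) ×ˢ ({0} : Set ℝ)) k

/-- `λ_k^{ND}(C(L,b))`: Neumann at `y = 0`, Dirichlet at `y = b`. -/
def lamND (L b : ℝ) (k : ℕ) : ℝ := eigenvalue L b ((univ : Set ℝ) ×ˢ ({b} : Set ℝ)) k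

/-- The generalized first eigenvalue `λ₁(ω)` of a (measurable) subset `ω` of the
cylinder: the infimum of the Rayleigh quotient over nonzero form-domain functions
vanishing a.e. on the complement of `ω`; it is `+∞` if no such function exists. -/
def lam1 (L b : ℝ) (T : Set (ℝ × ℝ)) (ω : Set (ℝ × ℝ)) : ℝ≥0∞ :=
  ⨅ u : {u : (ℝ × ℝ) → ℝ // u ∈ formDomain L b T ∧
      (∀ᵐ p ∂(volume.restrict (rect L b \ ω)), u p = 0) ∧ massInt L b u ≠ 0},
    ENNReal.ofReal (rayleigh L b u.1)

/-- A `k`-partition of the cylinder `C(L,b)`: `k` mutually disjoint nonempty open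
(`L`-periodic) subsets of the strip. -/
def IsCylPartition (L b : ℝ) {k : ℕ} (D : Fin k → Set (ℝ × ℝ)) : Prop :=
  (∀ i, IsOpen (D i) ∧ (D i).Nonempty ∧ D i ⊆ stripO b ∧
    ∀ p : ℝ × ℝ, p ∈ D i ↔ (p.1 + L, p.2) ∈ D i) ∧
  ∀ i j, i ≠ j → Disjoint (D i) (D j)

/-- The energy `Λ(𝒟) = max_i λ₁(D_i)` of a partition. -/
def energy (L b : ℝ) (T : Set (ℝ × ℝ)) {k : ℕ} (D : Fin k → Set (ℝ × ℝ)) : ℝ≥0∞ :=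
  ⨆ i, lam1 L b T (D i)

/-- The spectral minimal partition energy `𝔏_k = inf_𝒟 Λ(𝒟)`. -/
def frakL (L b : ℝ) (T : Set (ℝ × ℝ)) (k : ℕ) : ℝ≥0∞ :=
  ⨅ (D : Fin k → Set (ℝ × ℝ)) (_ : IsCylPartition L b D), energy L b T D

/-- `∂u/∂y`. -/
def pdy (u : (ℝ × ℝ) → ℝ) (p : ℝ × ℝ) : ℝ := fderiv ℝ u p (0, 1)

/-- The Laplacian `Δu = u_xx + u_yy`. -/
def lapl (u : (ℝ × ℝ) → ℝ) (p : ℝ × ℝ) : ℝ :=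
  fderiv ℝ (fun q => fderiv ℝ u q (1, 0)) p (1, 0) +
  fderiv ℝ (fun q => fderiv ℝ u q (0, 1)) p (0, 1)

/-- `u` is a (real, nonzero) eigenfunction of the Neumann Laplacian `-Δ^N` on
`C(L,b)` with eigenvalue `μ`: an `L`-periodic `C²` function with `-Δu = μ u` on the
strip and `∂u/∂y = 0` on both boundary components. -/
def IsNeumannEigenfun (L b : ℝ) (μ : ℝ) (u : (ℝ × ℝ) → ℝ) : Prop :=
  (∀ p : ℝ × ℝ, u (p.1 + L, p.2) = u p) ∧ ContDiff ℝ 2 u ∧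
  (∃ p ∈ stripC b, u p ≠ 0) ∧
  (∀ p ∈ stripC b, lapl u p = -(μ * u p)) ∧
  ∀ x : ℝ, pdy u (x, 0) = 0 ∧ pdy u (x, b) = 0

/-- `u` is an eigenfunction of the mixed Laplacian `-Δ^{ND}` on `C(L,b)`
(Neumann at `y = 0`, Dirichlet at `y = b`) with eigenvalue `μ`. -/
def IsNDEigenfun (L b : ℝ) (μ : ℝ) (u : (ℝ × ℝ) → ℝ) : Prop :=
  (∀ p : ℝ × ℝ, u (p.1 + L, p.2) = u p) ∧ ContDiff ℝ 2 u ∧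
  (∃ p ∈ stripC b, u p ≠ 0) ∧
  (∀ p ∈ stripC b, lapl u p = -(μ * u p)) ∧
  (∀ x : ℝ, pdy u (x, 0) = 0) ∧ ∀ x : ℝ, u (x, b) = 0

/-- Projection from the plane onto the cylinder `(ℝ/Lℤ) × ℝ`. -/
def projCyl (L : ℝ) (p : ℝ × ℝ) : AddCircle L × ℝ := ((p.1 : AddCircle L), p.2)

/-- The subset of the cylinder where (the descent of) `u` does not vanish. -/
def nonzeroSet (L b : ℝ) (u : (ℝ × ℝ) → ℝ) : Set (AddCircle L × ℝ) :=
  projCyl L '' {p : ℝ × ℝ | p ∈ stripO b ∧ u p ≠ 0}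

/-- The number of nodal domains of `u`, i.e. of connected components of
`C(L,b) ∖ u⁻¹(0)`. -/
def nodalCount (L b : ℝ) (u : (ℝ × ℝ) → ℝ) : ℕ :=
  Nat.card (ConnectedComponents (nonzeroSet L b u))

/-- The family `D` is exactly the family of nodal domains of `u` (as subsets of the
cylinder). -/
def IsNodalFamily (L b : ℝ) {k : ℕ} (u : (ℝ × ℝ) → ℝ) (D : Fin k → Set (ℝ × ℝ)) : Prop :=
  {S : Set (AddCircle L × ℝ) | ∃ i, S = projCyl L '' D i} =
    {S | ∃ q ∈ nonzeroSet L b u, S = connectedComponentIn (nonzeroSet L b u) q}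

/-- `λ_k^N(C(L,b))` is Courant sharp: some associated eigenfunction has exactly `k`
nodal domains. -/
def CourantSharpN (L b : ℝ) (k : ℕ) : Prop :=
  ∃ u, IsNeumannEigenfun L b (lamN L b k) u ∧ nodalCount L b u = k

/-- The `ℓ`-th (for `ℓ = 0, …, k-1`) of the `k` equal vertical pieces of the cylinder
`C(L,b)`, i.e. the (`L`-periodized) open rectangle `(ℓL/k, (ℓ+1)L/k) × (0,b)`. -/
def equalPart (L b : ℝ) (k : ℕ) (ℓ : ℕ) : Set (ℝ × ℝ) :=
  {p : ℝ × ℝ | (∃ n : ℤ, p.1 - n * L ∈ Ioo ((ℓ : ℝ) * L / k) (((ℓ : ℝ) + 1) * L / k)) ∧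
    p.2 ∈ Ioo 0 b}

/-- The inclusion `D ↪ C(L,b)` (for `D` an `L`-periodic subset of the strip) is
homotopic to a constant map, i.e. `D` is `0`-homotopic in the cylinder. -/
def NullHomotopicIn (L : ℝ) (D : Set (ℝ × ℝ)) : Prop :=
  ∃ q : AddCircle L × ℝ,
    ContinuousMap.Homotopic
      ⟨fun x : (projCyl L '' D) => (x : AddCircle L × ℝ), continuous_subtype_val⟩
      ⟨fun _ => q, continuous_const⟩

/-! ## The circle `S¹ = ℝ/ℤ` of perimeter 1 (one-dimensional analogues). -/

/-- Form domain on the circle: `1`-periodic `C¹` functions on `ℝ`. -/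
def circleFormDomain : Submodule ℝ (ℝ → ℝ) where
  carrier := {u | (∀ x : ℝ, u (x + 1) = u x) ∧ ContDiff ℝ 1 u}
  zero_mem' := ⟨fun _ => rfl, contDiff_const⟩
  add_mem' := by
    rintro u v ⟨hu1, hu2⟩ ⟨hv1, hv2⟩
    exact ⟨fun x => by simp [hu1 x, hv1 x], hu2.add hv2⟩
  smul_mem' := by
    rintro c u ⟨hu1, hu2⟩
    exact ⟨fun x => by simp [hu1 x], hu2.const_smul c⟩

def circleEnergy (u : ℝ → ℝ) : ℝ := ∫ x in Ioo (0:ℝ) 1, deriv u x ^ 2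

def circleMass (u : ℝ → ℝ) : ℝ := ∫ x in Ioo (0:ℝ) 1, u x ^ 2

/-- `λ₁(ω)` for a subset `ω` of the circle. -/
def circleLam1 (ω : Set ℝ) : ℝ≥0∞ :=
  ⨅ u : {u : ℝ → ℝ // u ∈ circleFormDomain ∧
      (∀ᵐ x ∂(volume.restrict (Ioo (0:ℝ) 1 \ ω)), u x = 0) ∧ circleMass u ≠ 0},
    ENNReal.ofReal (circleEnergy u.1 / circleMass u.1)

/-- A `k`-partition of the circle: mutually disjoint nonempty open (1-periodic)
subsets of `ℝ`. -/
def IsCirclePartition {k : ℕ} (D : Fin k → Set ℝ) : Prop :=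
  (∀ i, IsOpen (D i) ∧ (D i).Nonempty ∧ ∀ x : ℝ, x ∈ D i ↔ x + 1 ∈ D i) ∧
  ∀ i j, i ≠ j → Disjoint (D i) (D j)

def circleEnergyP {k : ℕ} (D : Fin k → Set ℝ) : ℝ≥0∞ := ⨆ i, circleLam1 (D i)

/-- `𝔏_k(S¹)`. -/
def circleFrakL (k : ℕ) : ℝ≥0∞ :=
  ⨅ (D : Fin k → Set ℝ) (_ : IsCirclePartition D), circleEnergyP D

/-- `u` is a (real, nonzero) eigenfunction of `-d²/dx²` on the circle of
perimeter 1, with eigenvalue `μ`. -/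
def IsCircleEigenfun (μ : ℝ) (u : ℝ → ℝ) : Prop :=
  (∀ x : ℝ, u (x + 1) = u x) ∧ ContDiff ℝ 2 u ∧ u ≠ 0 ∧
  ∀ x : ℝ, deriv (deriv u) x = -(μ * u x)

/-- The subset of the circle where `u ≠ 0`. -/
def circleNonzeroSet (u : ℝ → ℝ) : Set (AddCircle (1:ℝ)) :=
  (fun x : ℝ => (x : AddCircle (1:ℝ))) '' {x : ℝ | u x ≠ 0}

/-- The arc `((ℓ)/k, (ℓ+1)/k)` of the circle, as a 1-periodic subset of `ℝ`. -/
def circleArc (k ℓ : ℕ) : Set ℝ :=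
  {x : ℝ | ∃ n : ℤ, x - n ∈ Ioo ((ℓ : ℝ) / k) (((ℓ : ℝ) + 1) / k)}

/-- The family `D` is the family of nodal domains (on the circle) of `u`. -/
def IsCircleNodalFamily {k : ℕ} (u : ℝ → ℝ) (D : Fin k → Set ℝ) : Prop :=
  {S : Set (AddCircle (1:ℝ)) | ∃ i, S = (fun x : ℝ => (x : AddCircle (1:ℝ))) '' D i} =
    {S | ∃ q ∈ circleNonzeroSet u, S = connectedComponentIn (circleNonzeroSet u) q}

end SMP

open SMP

theorem fourierCoeffOn_ofReal_eq_zero {a c : ℝ} (hac : a < c) {f : ℝ → ℝ}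
    (hf : ContinuousOn f (Icc a c)) {n : ℤ}
    (hcos : ∫ x in a..c, f x * cos (2 * π * n * x / (c - a)) = 0)
    (hsin : ∫ x in a..c, f x * sin (2 * π * n * x / (c - a)) = 0) :
    fourierCoeffOn hac (fun x => (f x : ℂ)) n = 0 := by
  have hint : ∀ g : ℝ → ℝ, Continuous g →
      IntervalIntegrable (fun x => f x * g x) volume a c := fun g hg =>
    (hf.mul hg.continuousOn).intervalIntegrable_of_Icc hac.le
  have h1 := hint _ (by fun_prop : Continuous fun x => cos (2 * π * n * x / (c - a)))
  have h2 := hint _ (by fun_prop : Continuous fun x => sin (2 * π * n * x / (c - a)))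
  rw [fourierCoeffOn_eq_integral]
  have : ∀ x : ℝ, fourier (-n) (x : AddCircle (c - a)) • (f x : ℂ) =
      ((f x * cos (2 * π * n * x / (c - a)) : ℝ) : ℂ) -
        ((f x * sin (2 * π * n * x / (c - a)) : ℝ) : ℂ) * Complex.I := by
    intro x
    rw [fourier_coe_apply]
    have : 2 * (π : ℂ) * Complex.I * ((-n : ℤ) : ℂ) * x / ((c - a : ℝ) : ℂ) =
        ((-(2 * π * n * x / (c - a)) : ℝ) : ℂ) * Complex.I := by
      push_cast; ring
    rw [this, Complex.exp_mul_I, ← Complex.ofReal_cos, ← Complex.ofReal_sin, cos_neg, sin_neg]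
    push_cast [smul_eq_mul]
    ring
  simp_rw [this]
  rw [intervalIntegral.integral_sub, intervalIntegral.integral_mul_const,
    intervalIntegral.integral_ofReal, intervalIntegral.integral_ofReal, hcos, hsin]
  · simp
  · exact ⟨h1.1.ofReal, h1.2.ofReal⟩
  · exact IntervalIntegrable.mul_const ⟨h2.1.ofReal, h2.2.ofReal⟩ _

/-- Wirtinger's inequality for functions orthogonal to the Fourier modes of order `< N`. -/
theorem wirtinger {a c : ℝ} (hac : a < c) {f f' : ℝ → ℝ} (hf : ContinuousOn f (Icc a c))
    (hd : ∀ x ∈ Ioo a c, HasDerivWithinAt f (f' x) (Ioi x) x)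
    (hf' : MemLp f' 2 (volume.restrict (Ioc a c))) (hper : f c = f a) (N : ℕ)
    (h0 : ∀ n : ℤ, |n| < N → (∫ x in a..c, f x * cos (2 * π * n * x / (c - a)) = 0) ∧
      ∫ x in a..c, f x * sin (2 * π * n * x / (c - a)) = 0) :
    (2 * π * N / (c - a)) ^ 2 * ∫ x in a..c, f x ^ 2 ≤ ∫ x in a..c, f' x ^ 2 := by
  have hT : 0 < c - a := sub_pos.2 hac
  have hfL : MemLp (fun x => (f x : ℂ)) 2 (volume.restrict (Ioc a c)) := by
    have : MemLp f 2 (volume.restrict (Ioc a c)) :=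
      (memLp_two_iff_integrable_sq
        ((hf.mono Ioc_subset_Icc_self).aestronglyMeasurable measurableSet_Ioc)).2
        ((hf.pow 2).integrableOn_Icc.mono_set Ioc_subset_Icc_self)
    exact this.ofReal
  have s1 := (hasSum_sq_fourierCoeffOn hac hfL).mul_left ((2 * π * N / (c - a)) ^ 2)
  have s2 := hasSum_sq_fourierCoeffOn hac (hf'.ofReal (K := ℂ))
  have hi : IntervalIntegrable (fun x => (f' x : ℂ)) volume a c := by
    rw [intervalIntegrable_iff_integrableOn_Ioc_of_le hac.le]
    exact (hf'.ofReal (K := ℂ)).integrable (by norm_num)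
  have key : ∀ n : ℤ, (2 * π * N / (c - a)) ^ 2 *
      ‖fourierCoeffOn hac (fun x => (f x : ℂ)) n‖ ^ 2 ≤
      ‖fourierCoeffOn hac (fun x => (f' x : ℂ)) n‖ ^ 2 := by
    intro n
    by_cases hn : |n| < N
    · rw [fourierCoeffOn_ofReal_eq_zero hac hf (h0 n hn).1 (h0 n hn).2]
      rw [norm_zero, zero_pow two_ne_zero, mul_zero]
      positivity
    by_cases hn0 : n = 0
    · have hN : N = 0 := by subst hn0; simpa using hn
      subst hN
      simp only [Nat.cast_zero, mul_zero, zero_div]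
      rw [zero_pow two_ne_zero, zero_mul]
      positivity
    have := fourierCoeffOn_of_hasDeriv_right hac (f := fun x => (f x : ℂ))
      (f' := fun x => (f' x : ℂ)) hn0
      (by rw [uIcc_of_le hac.le]; exact Complex.continuous_ofReal.comp_continuousOn hf)
      (by rw [min_eq_left hac.le, max_eq_right hac.le]
          exact fun x hx => (hd x hx).ofReal_comp) hi
    have hna : 0 < |(n : ℝ)| := abs_pos.2 (by exact_mod_cast hn0)
    have hn1 : (N : ℝ) ≤ |(n : ℝ)| := by exact_mod_cast not_lt.1 hn
    rw [hper, sub_self, mul_zero, zero_sub] at this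
    have hnorm : ‖fourierCoeffOn hac (fun x => (f x : ℂ)) n‖ =
        (c - a) / (2 * π * |(n : ℝ)|) * ‖fourierCoeffOn hac (fun x => (f' x : ℂ)) n‖ := by
      rw [this, ← Complex.ofReal_sub]
      simp only [norm_mul, norm_div, norm_neg, Complex.norm_real, Complex.norm_I, norm_one,
        Complex.norm_intCast, Real.norm_eq_abs, abs_of_pos hT, abs_of_pos pi_pos]
      norm_num
      field_simp
    rw [hnorm, ← mul_pow, ← mul_assoc]
    apply pow_le_pow_left₀ (by positivity)
    have : 2 * π * N / (c - a) * ((c - a) / (2 * π * |(n : ℝ)|)) = N / |(n : ℝ)| := by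
      field_simp
    rw [this]
    exact mul_le_of_le_one_left (norm_nonneg _) ((div_le_one hna).2 hn1)
  have := hasSum_le key s1 s2
  simp only [RCLike.norm_ofReal, Complex.norm_real, Real.norm_eq_abs, sq_abs, smul_eq_mul] at this
  have h3 : (c - a)⁻¹ * ((2 * π * N / (c - a)) ^ 2 * ∫ x in a..c, f x ^ 2) ≤
      (c - a)⁻¹ * ∫ x in a..c, f' x ^ 2 := by
    rwa [mul_left_comm]
  exact le_of_mul_le_mul_left h3 (inv_pos.2 hT)

theorem integral_symm_of_even {b : ℝ} {h : ℝ → ℝ} (hc : Continuous h) (he : ∀ x, h (-x) = h x) :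
    ∫ x in -b..b, h x = 2 * ∫ x in 0..b, h x := by
  rw [← intervalIntegral.integral_add_adjacent_intervals (hc.intervalIntegrable (-b) 0)
    (hc.intervalIntegrable 0 b)]
  have := intervalIntegral.integral_comp_neg (a := -b) (b := 0) h
  simp only [he, neg_zero, neg_neg] at this
  rw [this]; ring

theorem integral_symm_of_odd {b : ℝ} {h : ℝ → ℝ} (ho : ∀ x, h (-x) = -h x) :
    ∫ x in -b..b, h x = 0 := by
  have := intervalIntegral.integral_comp_neg (a := -b) (b := b) h
  simp only [ho, neg_neg, intervalIntegral.integral_neg] at this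
  linarith

/-- The Neumann Poincaré inequality on `(0,b)` for functions orthogonal to the first two modes. -/
theorem wirtinger_neumann {b : ℝ} (hb : 0 < b) {g g' : ℝ → ℝ} (hg : Continuous g)
    (hg' : Continuous g') (hd : ∀ y ∈ Ioo 0 b, HasDerivAt g (g' y) y)
    (h0 : ∫ y in 0..b, g y = 0) (h1 : ∫ y in 0..b, g y * cos (π * y / b) = 0) :
    (2 * π / b) ^ 2 * ∫ y in 0..b, g y ^ 2 ≤ ∫ y in 0..b, g' y ^ 2 := by
  have hd0 : HasDerivWithinAt g (g' 0) (Ici 0) 0 := by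
    refine hasDerivWithinAt_Ici_of_tendsto_deriv (s := Ioo 0 b)
      (fun y hy => (hd y hy).differentiableAt.differentiableWithinAt) hg.continuousWithinAt
      (Ioo_mem_nhdsGT hb) ?_
    refine (hg'.tendsto 0 |>.mono_left nhdsWithin_le_nhds).congr' ?_
    filter_upwards [Ioo_mem_nhdsGT hb] with y hy using (hd y hy).deriv.symm
  set f' : ℝ → ℝ := fun y => if y < 0 then -g' (-y) else g' y with hf'
  have hsq : ∀ y, f' y ^ 2 = g' |y| ^ 2 := by
    intro y
    by_cases hy : y < 0
    · simp [hf', hy, abs_of_neg hy]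
    · simp [hf', hy, abs_of_nonneg (not_lt.1 hy)]
  have hga : Continuous fun y => g |y| := hg.comp continuous_abs
  have main := wirtinger (a := -b) (c := b) (by linarith) (f := fun y => g |y|) (f' := f')
    hga.continuousOn ?_ ?_ (by simp) 2 ?_
  · simp only [hsq] at main
    rw [integral_symm_of_even (by fun_prop) (by simp),
      integral_symm_of_even (by fun_prop) (by simp)] at main
    have e : ∀ k : ℝ → ℝ, ∫ y in 0..b, k |y| ^ 2 = ∫ y in 0..b, k y ^ 2 := fun k => by
      refine intervalIntegral.integral_congr fun y hy => ?_
      rw [uIcc_of_le hb.le] at hy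
      simp [abs_of_nonneg hy.1]
    rw [e g, e g'] at main
    have e2 : 2 * π * ((2 : ℕ) : ℝ) / (b - -b) = 2 * π / b := by
      field_simp; push_cast; ring
    rw [e2] at main
    linarith
  · intro y hy
    rcases lt_trichotomy y 0 with h | h | h
    · have h2 : HasDerivAt (fun y => g (-y)) (-g' (-y)) y := by
        have h3 := (hd (-y) ⟨by linarith, by linarith [hy.1]⟩).comp y (hasDerivAt_neg y)
        exact h3.congr_deriv (by ring)
      have h3 : HasDerivAt (fun y => g |y|) (-g' (-y)) y :=
        h2.congr_of_eventuallyEq (by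
          filter_upwards [gt_mem_nhds h] with z hz
          rw [abs_of_neg hz])
      simpa [hf', h] using h3.hasDerivWithinAt
    · subst h
      have := (hd0.mono Ioi_subset_Ici_self).congr (f₁ := fun y => g |y|)
        (fun z hz => by rw [abs_of_pos hz]) (by simp)
      simpa [hf'] using this
    · have h3 : HasDerivAt (fun y => g |y|) (g' y) y :=
        (hd y ⟨h, hy.2⟩).congr_of_eventuallyEq (by
          filter_upwards [lt_mem_nhds h] with z hz
          rw [abs_of_pos hz])
      simpa [hf', h.not_gt] using h3.hasDerivWithinAt
  · have hm : Measurable f' :=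
      Measurable.ite measurableSet_Iio (by fun_prop) hg'.measurable
    refine (memLp_two_iff_integrable_sq hm.aestronglyMeasurable).2 ?_
    simp only [hsq]
    exact (by fun_prop : Continuous fun y => g' |y| ^ 2).integrableOn_Ioc
  · intro n hn
    refine ⟨?_, integral_symm_of_odd fun x => ?_⟩
    · rw [integral_symm_of_even (by fun_prop) (fun x => by
        rw [abs_neg, ← cos_neg]; congr 2; ring)]
      have hn : n = -1 ∨ n = 0 ∨ n = 1 := by
        have := abs_lt.1 hn
        push_cast at this
        omega
      have e : ∫ y in 0..b, g |y| * cos (2 * π * n * y / (b - -b)) =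
          ∫ y in 0..b, g y * cos (n * (π * y / b)) := by
        refine intervalIntegral.integral_congr fun y hy => ?_
        rw [uIcc_of_le hb.le] at hy
        simp only [abs_of_nonneg hy.1]
        congr 2; field_simp; ring
      rw [e]
      rcases hn with rfl | rfl | rfl <;> simp [h0, h1]
    · rw [abs_neg, ← mul_neg, ← sin_neg]; congr 2; ring

theorem hasDerivAt_intervalIntegral_param {F F' : ℝ × ℝ → ℝ} (hF : Continuous F)
    (hF' : Continuous F') {c d y : ℝ} (hy : y ∈ Ioo c d)
    (hd : ∀ x, ∀ t ∈ Ioo c d, HasDerivAt (fun s => F (x, s)) (F' (x, t)) t) :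
    HasDerivAt (fun t => ∫ x in (0:ℝ)..1, F (x, t)) (∫ x in (0:ℝ)..1, F' (x, y)) y := by
  obtain ⟨M, hM⟩ := ((isCompact_Icc (a := (0:ℝ)) (b := 1)).prod
    (isCompact_Icc (a := c) (b := d))).exists_bound_of_continuousOn hF'.continuousOn
  refine (intervalIntegral.hasDerivAt_integral_of_dominated_loc_of_deriv_le
    (F := fun t x => F (x, t)) (F' := fun t x => F' (x, t)) (bound := fun _ => M)
    (Ioo_mem_nhds hy.1 hy.2) (.of_forall fun t => ?_) ?_ ?_ (.of_forall fun x hx t ht => ?_)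
    (by simp) (.of_forall fun x _ t ht => hd x t ht)).2
  · exact (by fun_prop : Continuous fun x => F (x, t)).aestronglyMeasurable
  · exact (by fun_prop : Continuous fun x => F (x, y)).intervalIntegrable _ _
  · exact (by fun_prop : Continuous fun x => F' (x, y)).aestronglyMeasurable
  · rw [uIoc_of_le zero_le_one] at hx
    exact hM (x, t) ⟨Ioc_subset_Icc_self hx, Ioo_subset_Icc_self ht⟩

theorem setIntegral_rect_eq {b : ℝ} (hb : 0 < b) {F : ℝ × ℝ → ℝ} (hF : Continuous F) :
    ∫ p in rect 1 b, F p = ∫ y in 0..b, ∫ x in (0:ℝ)..1, F (x, y) := by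
  have h : ∫ p in rect 1 b, F p = ∫ p in Ioc (0:ℝ) 1 ×ˢ Ioc 0 b, F p := by
    refine setIntegral_congr_set ?_
    rw [Measure.volume_eq_prod]
    exact Measure.set_prod_ae_eq Ioo_ae_eq_Ioc Ioo_ae_eq_Ioc
  have hi : IntegrableOn (fun p : ℝ × ℝ => F p.swap) (Ioc 0 b ×ˢ Ioc (0:ℝ) 1)
      (volume.prod volume) :=
    ((hF.comp continuous_swap).continuousOn.integrableOn_compact
      (isCompact_Icc.prod isCompact_Icc)).mono_set
      (prod_mono Ioc_subset_Icc_self Ioc_subset_Icc_self)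
  rw [h, Measure.volume_eq_prod, ← setIntegral_prod_swap, setIntegral_prod _ hi,
    intervalIntegral.integral_of_le hb.le]
  simp_rw [intervalIntegral.integral_of_le zero_le_one]
  rfl

theorem setIntegral_rect_eq' {b : ℝ} (hb : 0 < b) {F : ℝ × ℝ → ℝ} (hF : Continuous F) :
    ∫ p in rect 1 b, F p = ∫ x in (0:ℝ)..1, ∫ y in 0..b, F (x, y) := by
  have h : ∫ p in rect 1 b, F p = ∫ p in Ioc (0:ℝ) 1 ×ˢ Ioc 0 b, F p := by
    refine setIntegral_congr_set ?_
    rw [Measure.volume_eq_prod]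
    exact Measure.set_prod_ae_eq Ioo_ae_eq_Ioc Ioo_ae_eq_Ioc
  have hi : IntegrableOn F (Ioc (0:ℝ) 1 ×ˢ Ioc 0 b) (volume.prod volume) :=
    (hF.continuousOn.integrableOn_compact (isCompact_Icc.prod isCompact_Icc)).mono_set
      (prod_mono Ioc_subset_Icc_self Ioc_subset_Icc_self)
  rw [h, Measure.volume_eq_prod, setIntegral_prod _ hi,
    intervalIntegral.integral_of_le zero_le_one]
  simp_rw [intervalIntegral.integral_of_le hb.le]

theorem continuous_sq {X : Type*} [TopologicalSpace X] {f : X → ℝ} (hf : Continuous f) :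
    Continuous fun x => f x ^ 2 := hf.pow 2

/-- The horizontal average of `u` at height `y`. -/
def hmean (u : ℝ × ℝ → ℝ) (y : ℝ) : ℝ := ∫ x in (0:ℝ)..1, u (x, y)

theorem continuous_hmean {u : ℝ × ℝ → ℝ} (hu : Continuous u) : Continuous (hmean u) :=
  intervalIntegral.continuous_parametric_intervalIntegral_of_continuous'
    (f := fun y x => u (x, y)) (by fun_prop) 0 1

theorem integral_sub_mean_sq {h : ℝ → ℝ} (hc : Continuous h) :
    ∫ x in (0:ℝ)..1, (h x - ∫ t in (0:ℝ)..1, h t) ^ 2 =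
      (∫ x in (0:ℝ)..1, h x ^ 2) - (∫ t in (0:ℝ)..1, h t) ^ 2 := by
  set m := ∫ t in (0:ℝ)..1, h t with hm
  have e : ∀ x, (h x - m) ^ 2 = h x ^ 2 - (2 * m * h x - m ^ 2) := fun x => by ring
  simp_rw [e]
  rw [intervalIntegral.integral_sub ((continuous_sq hc).intervalIntegrable _ _)
      ((by fun_prop : Continuous fun x => 2 * m * h x - m ^ 2).intervalIntegrable _ _),
    intervalIntegral.integral_sub ((hc.const_mul _).intervalIntegrable _ _)
      (continuous_const.intervalIntegrable _ _), intervalIntegral.integral_const_mul, ← hm,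
    intervalIntegral.integral_const]
  simp only [sub_zero, one_smul]
  ring

theorem sq_integral_le {h : ℝ → ℝ} (hc : Continuous h) :
    (∫ x in (0:ℝ)..1, h x) ^ 2 ≤ ∫ x in (0:ℝ)..1, h x ^ 2 := by
  have h1 := integral_sub_mean_sq hc
  have h2 : 0 ≤ ∫ x in (0:ℝ)..1, (h x - ∫ t in (0:ℝ)..1, h t) ^ 2 :=
    intervalIntegral.integral_nonneg zero_le_one fun x _ => sq_nonneg _
  linarith

theorem wirtinger_periodic {f f' : ℝ → ℝ} (hf' : Continuous f')
    (hd : ∀ x, HasDerivAt f (f' x) x) (hper : f 1 = f 0) :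
    (2 * π) ^ 2 * ∫ x in (0:ℝ)..1, (f x - ∫ t in (0:ℝ)..1, f t) ^ 2 ≤
      ∫ x in (0:ℝ)..1, f' x ^ 2 := by
  have hf : Continuous f := continuous_iff_continuousAt.2 fun x => (hd x).continuousAt
  have := wirtinger (a := 0) (c := 1) zero_lt_one
    (f := fun x => f x - ∫ t in (0:ℝ)..1, f t) (f' := f') (by fun_prop)
    (fun x _ => ((hd x).sub_const _).hasDerivWithinAt)
    ((memLp_two_iff_integrable_sq hf'.aestronglyMeasurable).2 (continuous_sq hf').integrableOn_Ioc)
    (by rw [hper]) 1 ?_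
  · simpa using this
  · intro n hn
    have : n = 0 := by simpa using hn
    subst this
    simp [intervalIntegral.integral_sub (hf.intervalIntegrable _ _)]

section Rect

variable {b : ℝ} {u ux uy : ℝ × ℝ → ℝ}

theorem rect_poincare_x (hb : 0 < b) (hu : Continuous u) (hux : Continuous ux)
    (hdx : ∀ y ∈ Ioo 0 b, ∀ x, HasDerivAt (fun t => u (t, y)) (ux (x, y)) x)
    (hper : ∀ y ∈ Ioo 0 b, u (1, y) = u (0, y)) :
    (2 * π) ^ 2 * ((∫ p in rect 1 b, u p ^ 2) - ∫ y in 0..b, hmean u y ^ 2) ≤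
      ∫ p in rect 1 b, ux p ^ 2 := by
  have hm := continuous_hmean hu
  have hm2 : Continuous fun y => ∫ x in (0:ℝ)..1, u (x, y) ^ 2 :=
    continuous_hmean (continuous_sq hu)
  rw [setIntegral_rect_eq hb (continuous_sq hu), setIntegral_rect_eq hb (continuous_sq hux),
    ← intervalIntegral.integral_sub (hm2.intervalIntegrable _ _)
      ((continuous_sq hm).intervalIntegrable _ _), ← intervalIntegral.integral_const_mul]
  refine intervalIntegral.integral_mono_on_of_le_Ioo hb.le
    (((hm2.sub (continuous_sq hm)).const_mul _).intervalIntegrable _ _)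
    ((continuous_hmean (continuous_sq hux)).intervalIntegrable _ _) fun y hy => ?_
  have h1 := wirtinger_periodic (f := fun x => u (x, y)) (f' := fun x => ux (x, y))
    (by fun_prop) (hdx y hy) (hper y hy)
  rwa [integral_sub_mean_sq (by fun_prop)] at h1

theorem rect_poincare (hb : 0 < b) (hu : Continuous u) (hux : Continuous ux) (huy : Continuous uy)
    (hdx : ∀ y ∈ Ioo 0 b, ∀ x, HasDerivAt (fun t => u (t, y)) (ux (x, y)) x)
    (hdy : ∀ x, ∀ y ∈ Ioo 0 b, HasDerivAt (fun t => u (x, t)) (uy (x, y)) y)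
    (hper : ∀ y ∈ Ioo 0 b, u (1, y) = u (0, y))
    (h0 : ∫ p in rect 1 b, u p = 0) (h1 : ∫ p in rect 1 b, u p * cos (π * p.2 / b) = 0)
    {μ : ℝ} (hμ1 : μ ≤ (2 * π) ^ 2) (hμ2 : μ ≤ (2 * π / b) ^ 2) :
    μ * ∫ p in rect 1 b, u p ^ 2 ≤ (∫ p in rect 1 b, ux p ^ 2) + ∫ p in rect 1 b, uy p ^ 2 := by
  have hm := continuous_hmean hu
  have hx := rect_poincare_x hb hu hux hdx hper
  rw [setIntegral_rect_eq hb (by fun_prop)] at h0 h1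
  simp only [intervalIntegral.integral_mul_const] at h1
  have hy := wirtinger_neumann hb hm (continuous_hmean huy)
    (fun y hy => hasDerivAt_intervalIntegral_param hu huy hy hdy) h0 h1
  have hy2 : ∫ y in 0..b, hmean uy y ^ 2 ≤ ∫ p in rect 1 b, uy p ^ 2 := by
    rw [setIntegral_rect_eq hb (continuous_sq huy)]
    refine intervalIntegral.integral_mono_on hb.le
      ((continuous_sq (continuous_hmean huy)).intervalIntegrable _ _)
      ((continuous_hmean (continuous_sq huy)).intervalIntegrable _ _) fun y _ => ?_
    exact sq_integral_le (h := fun x => uy (x, y)) (by fun_prop)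
  have hB : 0 ≤ ∫ y in 0..b, hmean u y ^ 2 :=
    intervalIntegral.integral_nonneg hb.le fun y _ => sq_nonneg _
  have hm2 : Continuous fun y => ∫ x in (0:ℝ)..1, u (x, y) ^ 2 :=
    continuous_hmean (continuous_sq hu)
  have hA : 0 ≤ (∫ p in rect 1 b, u p ^ 2) - ∫ y in 0..b, hmean u y ^ 2 := by
    rw [setIntegral_rect_eq hb (continuous_sq hu), ← intervalIntegral.integral_sub
      (hm2.intervalIntegrable _ _) ((continuous_sq hm).intervalIntegrable _ _)]
    exact intervalIntegral.integral_nonneg hb.le fun y _ =>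
      sub_nonneg.2 (sq_integral_le (h := fun x => u (x, y)) (by fun_prop))
  have e1 := mul_le_mul_of_nonneg_right hμ1 hA
  have e2 := mul_le_mul_of_nonneg_right hμ2 hB
  linarith

end Rect

theorem norm_eq_abs_add_abs (L : ℝ × ℝ →L[ℝ] ℝ) : ‖L‖ = |L (1, 0)| + |L (0, 1)| := by
  have hL : ∀ p : ℝ × ℝ, L p = p.1 * L (1, 0) + p.2 * L (0, 1) := by
    intro p
    have : p = p.1 • ((1, 0) : ℝ × ℝ) + p.2 • ((0, 1) : ℝ × ℝ) := by
      ext <;> simp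
    conv_lhs => rw [this, map_add, map_smul, map_smul, smul_eq_mul, smul_eq_mul]
  apply le_antisymm
  · refine L.opNorm_le_bound (by positivity) fun p => ?_
    rw [hL p, Real.norm_eq_abs]
    have h1 : |p.1| ≤ ‖p‖ := norm_fst_le p
    have h2 : |p.2| ≤ ‖p‖ := norm_snd_le p
    calc _ ≤ |p.1 * L (1, 0)| + |p.2 * L (0, 1)| := abs_add_le _ _
      _ = |p.1| * |L (1, 0)| + |p.2| * |L (0, 1)| := by rw [abs_mul, abs_mul]
      _ ≤ ‖p‖ * |L (1, 0)| + ‖p‖ * |L (0, 1)| := by gcongr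
      _ = _ := by ring
  · have h := L.le_opNorm ((SignType.sign (L (1, 0)) : ℝ), (SignType.sign (L (0, 1)) : ℝ))
    rw [hL, Real.norm_eq_abs] at h
    simp only [sign_mul_self] at h
    have hs : ∀ x : ℝ, ‖(SignType.sign x : ℝ)‖ ≤ 1 := by
      intro x
      rcases lt_trichotomy x 0 with hx | hx | hx <;> simp [hx]
    have h2 : ‖(((SignType.sign (L (1, 0)) : ℝ), (SignType.sign (L (0, 1)) : ℝ)) : ℝ × ℝ)‖ ≤ 1 :=
      max_le (hs _) (hs _)
    calc _ ≤ _ := le_abs_self _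
      _ ≤ _ := h
      _ ≤ ‖L‖ := mul_le_of_le_one_right (norm_nonneg _) h2

section LowerBound

variable {b : ℝ}

theorem rect_subset_stripO : rect 1 b ⊆ stripO b := prod_mono (subset_univ _) Subset.rfl

theorem stripO_subset_stripC : stripO b ⊆ stripC b := prod_mono Subset.rfl Ioo_subset_Icc_self

theorem isOpen_stripO : IsOpen (stripO b) := isOpen_univ.prod isOpen_Ioo

theorem measurableSet_rect : MeasurableSet (rect 1 b) := measurableSet_Ioo.prod measurableSet_Ioo

theorem integrableOn_rect {F : ℝ × ℝ → ℝ} (hF : ContinuousOn F (stripC b)) :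
    IntegrableOn F (rect 1 b) :=
  ((hF.mono (prod_mono (subset_univ (Icc (0:ℝ) 1)) Subset.rfl)).integrableOn_compact
    (isCompact_Icc.prod isCompact_Icc)).mono_set
    (prod_mono Ioo_subset_Icc_self Ioo_subset_Icc_self)

theorem massInt_nonneg (u : ℝ × ℝ → ℝ) : 0 ≤ massInt 1 b u :=
  integral_nonneg fun _ => sq_nonneg _

/-- A function that is `C¹` up to the boundary of the strip has continuous partial derivatives,
extended constantly in the vertical direction. -/
theorem exists_continuous_partials (hb : 0 < b) {u : ℝ × ℝ → ℝ}
    (hu : ContDiffOn ℝ 1 u (stripC b)) :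
    ∃ v vx vy : ℝ × ℝ → ℝ, Continuous v ∧ Continuous vx ∧ Continuous vy ∧
      (∀ p ∈ stripC b, v p = u p) ∧ ∀ p ∈ stripO b, DifferentiableAt ℝ u p ∧
        fderiv ℝ u p (1, 0) = vx p ∧ fderiv ℝ u p (0, 1) = vy p := by
  have hs : UniqueDiffOn ℝ (stripC b) := uniqueDiffOn_univ.prod (uniqueDiffOn_Icc hb)
  let c : ℝ × ℝ → ℝ × ℝ := fun p => (p.1, max 0 (min p.2 b))
  have hc : Continuous c := by fun_prop
  have hcm : ∀ p, c p ∈ stripC b := fun p =>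
    ⟨mem_univ _, le_max_left _ _, max_le hb.le (min_le_right _ _)⟩
  have hce : ∀ p ∈ stripC b, c p = p := by
    rintro ⟨x, y⟩ ⟨-, h1, h2⟩
    simp only at h1 h2
    simp [c, min_eq_left h2, max_eq_right h1]
  have hD := hu.continuousOn_fderivWithin hs le_rfl
  have hcc : ∀ {Y : Type} [TopologicalSpace Y] {F : ℝ × ℝ → Y}, ContinuousOn F (stripC b) →
      Continuous (F ∘ c) := fun hF => hF.comp_continuous hc hcm
  refine ⟨u ∘ c, (fun p => fderivWithin ℝ u (stripC b) p (1, 0)) ∘ c,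
    (fun p => fderivWithin ℝ u (stripC b) p (0, 1)) ∘ c, hcc hu.continuousOn,
    hcc (hD.clm_apply continuousOn_const), hcc (hD.clm_apply continuousOn_const),
    fun p hp => by simp [hce p hp], fun p hp => ?_⟩
  have hn : stripC b ∈ nhds p :=
    mem_of_superset (isOpen_stripO.mem_nhds hp) stripO_subset_stripC
  simp only [Function.comp_apply, hce p (stripO_subset_stripC hp), fderivWithin_of_mem_nhds hn,
    and_true]
  exact (hu.differentiableOn one_ne_zero).differentiableAt hn

theorem mul_massInt_le_energyInt (hb : 0 < b) {u : ℝ × ℝ → ℝ} (hu : u ∈ formDomain 1 b ∅)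
    (h0 : ∫ p in rect 1 b, u p = 0) (h1 : ∫ p in rect 1 b, u p * cos (π * p.2 / b) = 0)
    {μ : ℝ} (hμ1 : μ ≤ (2 * π) ^ 2) (hμ2 : μ ≤ (2 * π / b) ^ 2) :
    μ * massInt 1 b u ≤ energyInt 1 b u := by
  obtain ⟨hper, hC, -⟩ := hu
  obtain ⟨v, vx, vy, hv, hvx, hvy, hvu, hd⟩ := exists_continuous_partials hb hC
  have hr : ∀ p ∈ rect 1 b, v p = u p := fun p hp =>
    hvu p (stripO_subset_stripC (rect_subset_stripO hp))
  have hvd : ∀ p ∈ stripO b, HasFDerivAt v (fderiv ℝ u p) p := fun p hp =>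
    (hd p hp).1.hasFDerivAt.congr_of_eventuallyEq
      (eventuallyEq_of_mem (isOpen_stripO.mem_nhds hp) fun q hq => hvu q (stripO_subset_stripC hq))
  have hm : massInt 1 b u = ∫ p in rect 1 b, v p ^ 2 :=
    setIntegral_congr_fun measurableSet_rect fun p hp => by simp only [hr p hp]
  have he : energyInt 1 b u = ∫ p in rect 1 b, (|vx p| + |vy p|) ^ 2 :=
    setIntegral_congr_fun measurableSet_rect fun p hp => by
      simp only [norm_eq_abs_add_abs, (hd p (rect_subset_stripO hp)).2.1,
        (hd p (rect_subset_stripO hp)).2.2]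
  have key := rect_poincare hb hv hvx hvy (μ := μ) (fun y hy x => ?_) (fun x y hy => ?_)
    (fun y hy => ?_) ?_ ?_ hμ1 hμ2
  · rw [hm, he]
    refine key.trans ?_
    rw [← integral_add (integrableOn_rect (continuous_sq hvx).continuousOn)
      (integrableOn_rect (continuous_sq hvy).continuousOn)]
    refine setIntegral_mono_on (integrableOn_rect (by fun_prop)) (integrableOn_rect (by fun_prop))
      measurableSet_rect fun p _ => ?_
    nlinarith [sq_abs (vx p), sq_abs (vy p), mul_nonneg (abs_nonneg (vx p)) (abs_nonneg (vy p))]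
  · have hp : (x, y) ∈ stripO b := ⟨mem_univ _, hy⟩
    have := (hvd _ hp).comp_hasDerivAt x ((hasDerivAt_id x).prodMk (hasDerivAt_const x y))
    rwa [(hd _ hp).2.1] at this
  · have hp : (x, y) ∈ stripO b := ⟨mem_univ _, hy⟩
    have := (hvd _ hp).comp_hasDerivAt y ((hasDerivAt_const y x).prodMk (hasDerivAt_id y))
    rwa [(hd _ hp).2.2] at this
  · rw [hvu _ ⟨mem_univ _, Ioo_subset_Icc_self hy⟩, hvu _ ⟨mem_univ _, Ioo_subset_Icc_self hy⟩]
    simpa using hper (0, y)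
  · rw [← h0]
    exact setIntegral_congr_fun measurableSet_rect hr
  · rw [← h1]
    exact setIntegral_congr_fun measurableSet_rect fun p hp => by simp only [hr p hp]

theorem le_lamN_three (hb : 0 < b) {μ : ℝ} (hμ1 : μ ≤ (2 * π) ^ 2) (hμ2 : μ ≤ (2 * π / b) ^ 2)
    {V : Submodule ℝ (ℝ × ℝ → ℝ)} (hV : V ≤ formDomain 1 b ∅) (h3 : Module.finrank ℝ V = 3)
    (hmass : ∀ u ∈ V, u ≠ 0 → massInt 1 b u ≠ 0) : ∃ u ∈ V, u ≠ 0 ∧ μ ≤ rayleigh 1 b u := by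
  have : Module.Finite ℝ V := Module.finite_of_finrank_pos (by omega)
  have hcont : ∀ u : V, ContinuousOn (u : ℝ × ℝ → ℝ) (stripC b) := fun u =>
    (hV u.2).2.1.continuousOn
  have hi : ∀ u : V, IntegrableOn (u : ℝ × ℝ → ℝ) (rect 1 b) := fun u =>
    integrableOn_rect (hcont u)
  have hi' : ∀ u : V, IntegrableOn (fun p => u.1 p * cos (π * p.2 / b)) (rect 1 b) := fun u =>
    integrableOn_rect ((hcont u).mul (by fun_prop))
  let T : V →ₗ[ℝ] ℝ × ℝ :=
    { toFun := fun u => (∫ p in rect 1 b, u.1 p, ∫ p in rect 1 b, u.1 p * cos (π * p.2 / b))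
      map_add' := fun u v => by
        ext
        · exact integral_add (hi u) (hi v)
        · simp only [Submodule.coe_add, Pi.add_apply, add_mul, Prod.snd_add]
          exact integral_add (hi' u) (hi' v)
      map_smul' := fun c u => by
        ext
        · exact integral_const_mul c _
        · simp only [Submodule.coe_smul, Pi.smul_apply, smul_eq_mul, mul_assoc, RingHom.id_apply,
            Prod.smul_snd]
          exact integral_const_mul c _ }
  have hker : T.ker ≠ ⊥ := LinearMap.ker_ne_bot_of_finrank_lt (by
    rw [h3, Module.finrank_prod, Module.finrank_self]; norm_num)
  obtain ⟨u, hu, hu0⟩ := (Submodule.ne_bot_iff _).1 hker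
  have hT : T u = 0 := hu
  have hne : (u : ℝ × ℝ → ℝ) ≠ 0 := fun h => hu0 (Subtype.ext h)
  refine ⟨u, u.2, hne, ?_⟩
  rw [rayleigh, le_div_iff₀ ((massInt_nonneg _).lt_of_ne' (hmass u u.2 hne))]
  exact mul_massInt_le_energyInt hb (hV u.2) (congrArg Prod.fst hT) (congrArg Prod.snd hT) hμ1 hμ2

end LowerBound

section UpperBound

variable {b : ℝ}

theorem lamN_three_eq (hb : 0 < b) {μ : ℝ} (hμ1 : μ ≤ (2 * π) ^ 2) (hμ2 : μ ≤ (2 * π / b) ^ 2)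
    (φ : Fin 3 → ℝ × ℝ → ℝ) (hφ : ∀ i, φ i ∈ formDomain 1 b ∅) {m : Fin 3 → ℝ} (hm : ∀ i, 0 < m i)
    (hmass : ∀ c : Fin 3 → ℝ, massInt 1 b (∑ i, c i • φ i) = ∑ i, c i ^ 2 * m i)
    (henergy : ∀ c : Fin 3 → ℝ, energyInt 1 b (∑ i, c i • φ i) ≤ μ * ∑ i, c i ^ 2 * m i) :
    lamN 1 b 3 = μ := by
  have hzero : ∀ c : Fin 3 → ℝ, ∑ i, c i ^ 2 * m i = 0 → c = 0 := fun c hc => by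
    rw [Finset.sum_eq_zero_iff_of_nonneg fun i _ => mul_nonneg (sq_nonneg _) (hm i).le] at hc
    funext i
    simpa [(hm i).ne'] using hc i (Finset.mem_univ i)
  have hli : LinearIndependent ℝ φ := Fintype.linearIndependent_iff.2 fun c hc i => by
    have := hmass c
    rw [hc] at this
    exact congrFun (hzero c (this.symm.trans (by simp [massInt]))) i
  have hmassV : ∀ u ∈ Submodule.span ℝ (range φ), u ≠ 0 → massInt 1 b u ≠ 0 := by
    intro u hu hu0 h
    obtain ⟨c, rfl⟩ := (Submodule.mem_span_range_iff_exists_fun ℝ).1 hu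
    rw [hmass] at h
    exact hu0 (by simp [hzero c h])
  have hmem : μ ∈ {Λ : ℝ | ∃ V : Submodule ℝ (ℝ × ℝ → ℝ), V ≤ formDomain 1 b ∅ ∧
      Module.finrank ℝ V = 3 ∧ (∀ u ∈ V, u ≠ 0 → massInt 1 b u ≠ 0) ∧
      ∀ u ∈ V, u ≠ 0 → rayleigh 1 b u ≤ Λ} := by
    refine ⟨Submodule.span ℝ (range φ), Submodule.span_le.2 (range_subset_iff.2 hφ),
      by rw [finrank_span_eq_card hli, Fintype.card_fin], hmassV, fun u hu hu0 => ?_⟩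
    have hpos := (massInt_nonneg u).lt_of_ne' (hmassV u hu hu0)
    obtain ⟨c, rfl⟩ := (Submodule.mem_span_range_iff_exists_fun ℝ).1 hu
    rw [rayleigh, div_le_iff₀ hpos, hmass]
    exact henergy c
  have hlow : ∀ Λ ∈ {Λ : ℝ | ∃ V : Submodule ℝ (ℝ × ℝ → ℝ), V ≤ formDomain 1 b ∅ ∧
      Module.finrank ℝ V = 3 ∧ (∀ u ∈ V, u ≠ 0 → massInt 1 b u ≠ 0) ∧
      ∀ u ∈ V, u ≠ 0 → rayleigh 1 b u ≤ Λ}, μ ≤ Λ := by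
    rintro Λ ⟨V, hV, h3, hmV, hray⟩
    obtain ⟨u, hu, hu0, h⟩ := le_lamN_three hb hμ1 hμ2 hV h3 hmV
    exact h.trans (hray u hu hu0)
  exact IsLeast.csInf_eq ⟨hmem, hlow⟩

theorem norm_fderiv_comp_snd {h : ℝ → ℝ} {h' : ℝ} {p : ℝ × ℝ} (hd : HasDerivAt h h' p.2) :
    ‖fderiv ℝ (fun q : ℝ × ℝ => h q.2) p‖ ^ 2 = h' ^ 2 := by
  have := hd.comp_hasFDerivAt p (hasFDerivAt_snd (𝕜 := ℝ))
  rw [show (fun q : ℝ × ℝ => h q.2) = h ∘ Prod.snd from rfl, this.fderiv, norm_eq_abs_add_abs]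
  simp

theorem norm_fderiv_comp_fst {h : ℝ → ℝ} {h' : ℝ} {p : ℝ × ℝ} (hd : HasDerivAt h h' p.1) :
    ‖fderiv ℝ (fun q : ℝ × ℝ => h q.1) p‖ ^ 2 = h' ^ 2 := by
  have := hd.comp_hasFDerivAt p (hasFDerivAt_fst (𝕜 := ℝ))
  rw [show (fun q : ℝ × ℝ => h q.1) = h ∘ Prod.fst from rfl, this.fderiv, norm_eq_abs_add_abs]
  simp

theorem setIntegral_rect_comp_snd (hb : 0 < b) {h : ℝ → ℝ} (hc : Continuous h) :
    ∫ p in rect 1 b, h p.2 = ∫ y in 0..b, h y := by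
  rw [setIntegral_rect_eq hb (by fun_prop)]
  simp

theorem setIntegral_rect_comp_fst (hb : 0 < b) {h : ℝ → ℝ} (hc : Continuous h) :
    ∫ p in rect 1 b, h p.1 = b * ∫ x in (0:ℝ)..1, h x := by
  rw [setIntegral_rect_eq' hb (by fun_prop)]
  simp

theorem hasDerivAt_sin_mul (ω x : ℝ) : HasDerivAt (fun t => sin (ω * t)) (ω * cos (ω * x)) x := by
  simpa [mul_comm] using ((hasDerivAt_id x).const_mul ω).sin

theorem hasDerivAt_cos_mul (ω x : ℝ) :
    HasDerivAt (fun t => cos (ω * t)) (-(ω * sin (ω * x))) x := by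
  simpa [mul_comm] using ((hasDerivAt_id x).const_mul ω).cos

theorem integral_cos_poly {ω T : ℝ} (hω : ω ≠ 0) (hT : ω * T = π) (a₀ a₁ a₂ a₃ a₄ : ℝ) :
    ∫ y in 0..T, (a₀ + a₁ * cos (1 * ω * y) + a₂ * cos (2 * ω * y) + a₃ * cos (3 * ω * y) +
      a₄ * cos (4 * ω * y)) = a₀ * T := by
  have hd : ∀ y, HasDerivAt (fun y => a₀ * y + a₁ / (1 * ω) * sin (1 * ω * y) +
      a₂ / (2 * ω) * sin (2 * ω * y) + a₃ / (3 * ω) * sin (3 * ω * y) +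
      a₄ / (4 * ω) * sin (4 * ω * y)) (a₀ + a₁ * cos (1 * ω * y) + a₂ * cos (2 * ω * y) +
      a₃ * cos (3 * ω * y) + a₄ * cos (4 * ω * y)) y := fun y => by
    have h := (((((hasDerivAt_id y).const_mul a₀).add
      ((hasDerivAt_sin_mul (1 * ω) y).const_mul (a₁ / (1 * ω)))).add
      ((hasDerivAt_sin_mul (2 * ω) y).const_mul (a₂ / (2 * ω)))).add
      ((hasDerivAt_sin_mul (3 * ω) y).const_mul (a₃ / (3 * ω)))).add
      ((hasDerivAt_sin_mul (4 * ω) y).const_mul (a₄ / (4 * ω)))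
    refine h.congr_deriv ?_
    field_simp
  rw [intervalIntegral.integral_eq_sub_of_hasDerivAt (fun y _ => hd y)
    ((by fun_prop : Continuous _).intervalIntegrable _ _)]
  have hs : ∀ n : ℕ, sin (n * ω * T) = 0 := fun n => by
    rw [mul_assoc, hT, sin_nat_mul_pi]
  have h1 := hs 1
  have h2 := hs 2
  have h3 := hs 3
  have h4 := hs 4
  push_cast at h1 h2 h3 h4
  simp only [h1, h2, h3, h4, mul_zero, sin_zero, add_zero, sub_zero]

theorem integral_cos_sin_poly (a₀ a₁ a₂ b₁ b₂ : ℝ) :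
    ∫ x in (0:ℝ)..1, (a₀ + a₁ * cos (2 * π * x) + a₂ * cos (4 * π * x) + b₁ * sin (2 * π * x) +
      b₂ * sin (4 * π * x)) = a₀ := by
  have hd : ∀ x, HasDerivAt (fun x => a₀ * x + a₁ / (2 * π) * sin (2 * π * x) +
      a₂ / (4 * π) * sin (4 * π * x) - b₁ / (2 * π) * cos (2 * π * x) -
      b₂ / (4 * π) * cos (4 * π * x)) (a₀ + a₁ * cos (2 * π * x) + a₂ * cos (4 * π * x) +
      b₁ * sin (2 * π * x) + b₂ * sin (4 * π * x)) x := fun x => by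
    have h := (((((hasDerivAt_id x).const_mul a₀).add
      ((hasDerivAt_sin_mul (2 * π) x).const_mul (a₁ / (2 * π)))).add
      ((hasDerivAt_sin_mul (4 * π) x).const_mul (a₂ / (4 * π)))).sub
      ((hasDerivAt_cos_mul (2 * π) x).const_mul (b₁ / (2 * π)))).sub
      ((hasDerivAt_cos_mul (4 * π) x).const_mul (b₂ / (4 * π)))
    refine h.congr_deriv ?_
    field_simp
    ring
  rw [intervalIntegral.integral_eq_sub_of_hasDerivAt (fun x _ => hd x)
    ((by fun_prop : Continuous _).intervalIntegrable _ _)]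
  have e : 4 * π = 2 * π + 2 * π := by ring
  simp [e, sin_add, cos_add]

theorem lamN_three_of_one_le (hb : 1 ≤ b) : lamN 1 b 3 = (2 * π / b) ^ 2 := by
  have hb0 : 0 < b := zero_lt_one.trans_le hb
  have hω : π / b ≠ 0 := (div_pos pi_pos hb0).ne'
  have hT : π / b * b = π := by field_simp
  let h : (Fin 3 → ℝ) → ℝ → ℝ := fun c y =>
    c 0 + c 1 * cos (π / b * y) + c 2 * cos (2 * (π / b) * y)
  let h' : (Fin 3 → ℝ) → ℝ → ℝ := fun c y =>
    c 1 * -(π / b * sin (π / b * y)) + c 2 * -(2 * (π / b) * sin (2 * (π / b) * y))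
  have hd : ∀ c y, HasDerivAt (h c) (h' c y) y := fun c y =>
    (((hasDerivAt_cos_mul (π / b) y).const_mul (c 1)).const_add (c 0)).add
      ((hasDerivAt_cos_mul (2 * (π / b)) y).const_mul (c 2))
  have hsum : ∀ c : Fin 3 → ℝ, ∑ i, c i • (![fun _ => 1, fun p => cos (π / b * p.2),
      fun p => cos (2 * (π / b) * p.2)] : Fin 3 → ℝ × ℝ → ℝ) i = fun p => h c p.2 := fun c => by
    funext p
    simp [Fin.sum_univ_three, h]
  refine lamN_three_eq hb0 ?_ le_rfl ![fun _ => 1, fun p => cos (π / b * p.2),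
    fun p => cos (2 * (π / b) * p.2)] ?_ (m := ![b, b / 2, b / 2]) ?_ ?_ ?_
  · gcongr
    exact div_le_self (by positivity) hb
  · intro i
    fin_cases i <;> refine ⟨fun p => rfl, ContDiff.contDiffOn ?_, by simp⟩ <;>
      simp <;> fun_prop
  · intro i
    fin_cases i <;> simp [hb0]
  · intro c
    rw [hsum, massInt, setIntegral_rect_comp_snd hb0 (h := fun y => h c y ^ 2)
      (by simp only [h]; fun_prop)]
    have e := integral_cos_poly hω hT (c 0 ^ 2 + c 1 ^ 2 / 2 + c 2 ^ 2 / 2)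
      (2 * c 0 * c 1 + c 1 * c 2) (2 * c 0 * c 2 + c 1 ^ 2 / 2) (c 1 * c 2) (c 2 ^ 2 / 2)
    rw [show (∑ i, c i ^ 2 * (![b, b / 2, b / 2] : Fin 3 → ℝ) i) =
      (c 0 ^ 2 + c 1 ^ 2 / 2 + c 2 ^ 2 / 2) * b by simp [Fin.sum_univ_three]; ring, ← e]
    refine intervalIntegral.integral_congr fun y _ => ?_
    simp only [h]
    set θ := π / b * y with hθ
    rw [show 1 * (π / b) * y = θ by ring, show 2 * (π / b) * y = 2 * θ by ring,
      show 3 * (π / b) * y = 3 * θ by ring, show 4 * (π / b) * y = 2 * (2 * θ) by ring,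
      cos_three_mul, cos_two_mul (2 * θ), cos_two_mul]
    ring
  · intro c
    rw [hsum, energyInt]
    simp_rw [norm_fderiv_comp_snd (hd c _)]
    rw [setIntegral_rect_comp_snd hb0 (h := fun y => h' c y ^ 2)
      (by simp only [h']; fun_prop)]
    have e := integral_cos_poly hω hT ((π / b) ^ 2 * (c 1 ^ 2 / 2 + 2 * c 2 ^ 2))
      ((π / b) ^ 2 * (2 * c 1 * c 2)) (-((π / b) ^ 2 * (c 1 ^ 2 / 2)))
      (-((π / b) ^ 2 * (2 * c 1 * c 2))) (-((π / b) ^ 2 * (2 * c 2 ^ 2)))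
    have e2 : ∫ y in 0..b, h' c y ^ 2 = (π / b) ^ 2 * (c 1 ^ 2 / 2 + 2 * c 2 ^ 2) * b := by
      rw [← e]
      refine intervalIntegral.integral_congr fun y _ => ?_
      simp only [h']
      set θ := π / b * y with hθ
      rw [show 1 * (π / b) * y = θ by ring, show 2 * (π / b) * y = 2 * θ by ring,
        show 3 * (π / b) * y = 3 * θ by ring, show 4 * (π / b) * y = 2 * (2 * θ) by ring,
        cos_three_mul, cos_two_mul (2 * θ), cos_two_mul, sin_two_mul]
      have hs := sin_sq θ
      linear_combination ((π / b) ^ 2 * (c 1 ^ 2 + 8 * c 1 * c 2 * cos θ +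
        16 * c 2 ^ 2 * cos θ ^ 2)) * hs
    rw [e2]
    have hp : 0 ≤ (π / b) ^ 2 * b := by positivity
    simp only [Fin.sum_univ_three, Matrix.cons_val_zero, Matrix.cons_val_one, Matrix.cons_val]
    rw [mul_div_assoc]
    nlinarith [mul_nonneg hp (sq_nonneg (c 0)), mul_nonneg hp (sq_nonneg (c 1))]

theorem lamN_three_of_le_one (hb : 0 < b) (hb1 : b ≤ 1) : lamN 1 b 3 = (2 * π) ^ 2 := by
  let h : (Fin 3 → ℝ) → ℝ → ℝ := fun c x =>
    c 0 + c 1 * cos (2 * π * x) + c 2 * sin (2 * π * x)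
  let h' : (Fin 3 → ℝ) → ℝ → ℝ := fun c x =>
    c 1 * -(2 * π * sin (2 * π * x)) + c 2 * (2 * π * cos (2 * π * x))
  have hd : ∀ c x, HasDerivAt (h c) (h' c x) x := fun c x =>
    (((hasDerivAt_cos_mul (2 * π) x).const_mul (c 1)).const_add (c 0)).add
      ((hasDerivAt_sin_mul (2 * π) x).const_mul (c 2))
  have hsum : ∀ c : Fin 3 → ℝ, ∑ i, c i • (![fun _ => 1, fun p => cos (2 * π * p.1),
      fun p => sin (2 * π * p.1)] : Fin 3 → ℝ × ℝ → ℝ) i = fun p => h c p.1 := fun c => by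
    funext p
    simp [Fin.sum_univ_three, h]
  have e4 : ∀ x : ℝ, 4 * π * x = 2 * (2 * π * x) := fun x => by ring
  refine lamN_three_eq hb le_rfl ?_ ![fun _ => 1, fun p => cos (2 * π * p.1),
    fun p => sin (2 * π * p.1)] ?_ (m := ![b, b / 2, b / 2]) ?_ ?_ ?_
  · gcongr
    exact le_div_self (by positivity) hb hb1
  · intro i
    fin_cases i
    · exact ⟨fun p => rfl, contDiffOn_const, by simp⟩
    · exact ⟨fun p => by simp [mul_add, cos_add_two_pi], ContDiff.contDiffOn (by simp; fun_prop),
        by simp⟩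
    · exact ⟨fun p => by simp [mul_add, sin_add_two_pi], ContDiff.contDiffOn (by simp; fun_prop),
        by simp⟩
  · intro i
    fin_cases i <;> simp [hb]
  · intro c
    rw [hsum, massInt, setIntegral_rect_comp_fst hb (h := fun x => h c x ^ 2)
      (by simp only [h]; fun_prop)]
    have e := integral_cos_sin_poly (c 0 ^ 2 + c 1 ^ 2 / 2 + c 2 ^ 2 / 2)
      (2 * c 0 * c 1) (c 1 ^ 2 / 2 - c 2 ^ 2 / 2) (2 * c 0 * c 2) (c 1 * c 2)
    rw [show (∑ i, c i ^ 2 * (![b, b / 2, b / 2] : Fin 3 → ℝ) i) =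
      b * (c 0 ^ 2 + c 1 ^ 2 / 2 + c 2 ^ 2 / 2) by simp [Fin.sum_univ_three]; ring, ← e]
    congr 1
    refine intervalIntegral.integral_congr fun x _ => ?_
    simp only [h, e4, cos_two_mul (2 * π * x), sin_two_mul (2 * π * x)]
    linear_combination c 2 ^ 2 * sin_sq (2 * π * x)
  · intro c
    rw [hsum, energyInt]
    simp_rw [norm_fderiv_comp_fst (hd c _)]
    rw [setIntegral_rect_comp_fst hb (h := fun x => h' c x ^ 2)
      (by simp only [h']; fun_prop)]
    have e := integral_cos_sin_poly ((2 * π) ^ 2 * (c 1 ^ 2 / 2 + c 2 ^ 2 / 2))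
      0 ((2 * π) ^ 2 * (c 2 ^ 2 / 2 - c 1 ^ 2 / 2)) 0 (-((2 * π) ^ 2 * (c 1 * c 2)))
    have e2 : ∫ x in (0:ℝ)..1, h' c x ^ 2 = (2 * π) ^ 2 * (c 1 ^ 2 / 2 + c 2 ^ 2 / 2) := by
      rw [← e]
      refine intervalIntegral.integral_congr fun x _ => ?_
      simp only [h', e4, cos_two_mul (2 * π * x), sin_two_mul (2 * π * x)]
      linear_combination ((2 * π) ^ 2 * c 1 ^ 2) * sin_sq (2 * π * x)
    rw [e2]
    have hp : 0 ≤ (2 * π) ^ 2 * b := by positivity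
    simp only [Fin.sum_univ_three, Matrix.cons_val_zero, Matrix.cons_val_one, Matrix.cons_val]
    nlinarith [mul_nonneg hp (sq_nonneg (c 0))]

end UpperBound

section ThreeDomains

variable {b : ℝ}

theorem fderiv_comp_snd {h : ℝ → ℝ} {h' : ℝ} {p : ℝ × ℝ} (hd : HasDerivAt h h' p.2) :
    fderiv ℝ (fun q : ℝ × ℝ => h q.2) p (1, 0) = 0 ∧
      fderiv ℝ (fun q : ℝ × ℝ => h q.2) p (0, 1) = h' := by
  have := hd.comp_hasFDerivAt p (hasFDerivAt_snd (𝕜 := ℝ))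
  rw [show (fun q : ℝ × ℝ => h q.2) = h ∘ Prod.snd from rfl, this.fderiv]
  simp

theorem isNeumannEigenfun_cos (hb : 0 < b) :
    IsNeumannEigenfun 1 b ((2 * π / b) ^ 2) fun p => cos (2 * π / b * p.2) := by
  set ω := 2 * π / b
  have h1 := fun q : ℝ × ℝ => fderiv_comp_snd (p := q) (hasDerivAt_cos_mul ω q.2)
  refine ⟨fun p => rfl, by fun_prop, ⟨(0, 0), ⟨mem_univ _, le_rfl, hb.le⟩, by simp⟩,
    fun p _ => ?_, fun x => ⟨?_, ?_⟩⟩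
  · have h2 := (fderiv_comp_snd (h := fun y => -(ω * sin (ω * y))) (p := p)
      ((hasDerivAt_sin_mul ω p.2).const_mul ω).neg).2
    simp only [lapl, (h1 _).1, (h1 _).2, h2, fderiv_fun_const]
    simp
    ring
  · simp [pdy, (h1 _).2]
  · rw [pdy, (h1 _).2, show ω * ((x, b) : ℝ × ℝ).2 = 2 * π by simp [ω]; field_simp]
    simp

theorem mem_nonzeroSet_comp_snd {h : ℝ → ℝ} {q : AddCircle (1:ℝ) × ℝ} :
    q ∈ nonzeroSet 1 b (fun p => h p.2) ↔ q.2 ∈ Ioo 0 b ∧ h q.2 ≠ 0 := by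
  constructor
  · rintro ⟨p, ⟨⟨-, hp⟩, hp0⟩, rfl⟩
    exact ⟨hp, hp0⟩
  · rintro ⟨hq, hq0⟩
    obtain ⟨x, hx⟩ := QuotientAddGroup.mk_surjective q.1
    exact ⟨(x, q.2), ⟨⟨mem_univ _, hq⟩, hq0⟩, Prod.ext hx rfl⟩

theorem nodalCount_cos (hb : 0 < b) : nodalCount 1 b (fun p => cos (2 * π / b * p.2)) = 3 := by
  let l : Fin 3 → ℝ := ![0, b / 4, 3 * b / 4]
  let r : Fin 3 → ℝ := ![b / 4, 3 * b / 4, b]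
  have hlr : ∀ i, l i < r i := fun i => by
    fin_cases i <;> simp [l, r] <;> linarith
  have hS : ∀ q : AddCircle (1:ℝ) × ℝ, q ∈ nonzeroSet 1 b (fun p => cos (2 * π / b * p.2)) ↔
      ∃ i, q.2 ∈ Ioo (l i) (r i) := fun q => by
    have hθ : ∀ t, 2 * π / b * (t * b) = 2 * π * t := fun t => by field_simp
    obtain ⟨t, ht⟩ : ∃ t, q.2 = t * b := ⟨q.2 / b, by field_simp⟩
    rw [mem_nonzeroSet_comp_snd (h := fun y => cos (2 * π / b * y)), Fin.exists_fin_succ,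
      Fin.exists_fin_two]
    simp only [ht, hθ, l, r, mem_Ioo, Matrix.cons_val_zero, Matrix.cons_val_succ,
      Matrix.cons_val_one]
    have hpi := pi_pos
    constructor
    · rintro ⟨⟨h0, h1⟩, hc⟩
      by_contra! hcon
      obtain ⟨c1, c2, c3⟩ := hcon
      rcases lt_trichotomy (t * b) (b / 4) with h | h | h
      · linarith [c1 h0]
      · have : t = 1 / 4 := by
          have : (t - 1 / 4) * b = 0 := by linarith
          rcases mul_eq_zero.1 this with h | h <;> linarith
        rw [this, show 2 * π * (1 / 4) = π / 2 by ring, cos_pi_div_two] at hc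
        exact hc rfl
      · have h' := c2 h
        rcases h'.eq_or_lt with h'' | h''
        · have : t = 3 / 4 := by
            have : (t - 3 / 4) * b = 0 := by linarith
            rcases mul_eq_zero.1 this with h | h <;> linarith
          rw [this, show 2 * π * (3 / 4) = π / 2 + π by ring, cos_add_pi, cos_pi_div_two] at hc
          simp at hc
        · linarith [c3 h'']
    · have key : ∀ s s', s * b < t * b → t * b < s' * b → s < t ∧ t < s' := fun s s' h h' =>
        ⟨lt_of_mul_lt_mul_right h hb.le, lt_of_mul_lt_mul_right h' hb.le⟩
      rintro (⟨h0, h1⟩ | ⟨h0, h1⟩ | ⟨h0, h1⟩)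
      · obtain ⟨k1, k2⟩ := key 0 (1 / 4) (by linarith) (by linarith)
        exact ⟨⟨h0, by linarith⟩, (cos_pos_of_mem_Ioo ⟨by nlinarith, by nlinarith⟩).ne'⟩
      · obtain ⟨k1, k2⟩ := key (1 / 4) (3 / 4) (by linarith) (by linarith)
        exact ⟨⟨by linarith, by linarith⟩,
          (cos_neg_of_pi_div_two_lt_of_lt (by nlinarith) (by nlinarith)).ne⟩
      · obtain ⟨k1, k2⟩ := key (3 / 4) 1 (by linarith) (by linarith)
        refine ⟨⟨by linarith, h1⟩, ?_⟩
        rw [← cos_sub_two_pi]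
        exact (cos_pos_of_mem_Ioo ⟨by nlinarith, by nlinarith⟩).ne'
  have hdisj : ∀ i j (y : ℝ), y ∈ Ioo (l i) (r i) → y ∈ Ioo (l j) (r j) → i = j := by
    rintro i j y ⟨h1, h2⟩ ⟨h3, h4⟩
    fin_cases i <;> fin_cases j <;> simp [l, r] at h1 h2 h3 h4 ⊢ <;> linarith
  let U : Fin 3 → Set (nonzeroSet 1 b fun p => cos (2 * π / b * p.2)) := fun i =>
    {q | q.1.2 ∈ Ioo (l i) (r i)}
  have hopen : ∀ i, IsOpen (U i) := fun i => isOpen_Ioo.preimage (by fun_prop)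
  have hU : ⋃ i, U i = univ := eq_univ_of_forall fun q => mem_iUnion.2 ((hS q.1).1 q.2)
  have hclopen : ∀ i, IsClopen (U i) := fun i => by
    refine ⟨⟨?_⟩, hopen i⟩
    have : (U i)ᶜ = ⋃ j ∈ {j | j ≠ i}, U j := by
      ext q
      simp only [mem_compl_iff, mem_iUnion, mem_ofPred_eq, exists_prop]
      refine ⟨fun h => ?_, fun ⟨j, hj, hq⟩ h => hj (hdisj j i _ hq h)⟩
      obtain ⟨j, hj⟩ := (hS q.1).1 q.2
      exact ⟨j, fun e => h (e ▸ hj), hj⟩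
    rw [this]
    exact isOpen_biUnion fun j _ => hopen j
  have himage : ∀ i, Subtype.val '' U i = univ ×ˢ Ioo (l i) (r i) := fun i => by
    ext q
    refine ⟨?_, fun hq => ⟨⟨q, (hS q).2 ⟨i, hq.2⟩⟩, hq.2, rfl⟩⟩
    rintro ⟨q, hq, rfl⟩
    exact ⟨mem_univ _, hq⟩
  have hconn : ∀ i, IsConnected (U i) := fun i => by
    have h1 : IsConnected (univ ×ˢ Ioo (l i) (r i) : Set (AddCircle (1:ℝ) × ℝ)) :=
      isConnected_univ.prod (isConnected_Ioo (hlr i))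
    rw [← himage i] at h1
    exact ⟨image_nonempty.1 h1.1, Topology.IsInducing.subtypeVal.isPreconnected_image.1 h1.2⟩
  rw [nodalCount, Nat.card_congr (ConnectedComponents.equivOfIsClopenOfIsConnected hclopen
    (fun i j hij => Set.disjoint_left.2 fun q h1 h2 => hij (hdisj i j _ h1 h2)) hU hconn)]
  simp

end ThreeDomains

section Classification

theorem ode_cos_sin {g g' : ℝ → ℝ} {ω T : ℝ} (hω : ω ≠ 0)
    (hd : ∀ t ∈ Icc 0 T, HasDerivAt g (g' t) t)
    (hd' : ∀ t ∈ Icc 0 T, HasDerivAt g' (-(ω ^ 2 * g t)) t) {t : ℝ} (ht : t ∈ Icc 0 T) :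
    g t = g 0 * cos (ω * t) + g' 0 / ω * sin (ω * t) ∧
      g' t = -(ω * g 0 * sin (ω * t)) + g' 0 * cos (ω * t) := by
  have hP : ∀ s ∈ Icc 0 T,
      HasDerivAt (fun s => g s * cos (ω * s) - g' s / ω * sin (ω * s)) 0 s := fun s hs => by
    refine (((hd s hs).mul (hasDerivAt_cos_mul ω s)).sub
      (((hd' s hs).div_const ω).mul (hasDerivAt_sin_mul ω s))).congr_deriv ?_
    field_simp
    ring
  have hQ : ∀ s ∈ Icc 0 T,
      HasDerivAt (fun s => g s * sin (ω * s) + g' s / ω * cos (ω * s)) 0 s := fun s hs => by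
    refine (((hd s hs).mul (hasDerivAt_sin_mul ω s)).add
      (((hd' s hs).div_const ω).mul (hasDerivAt_cos_mul ω s))).congr_deriv ?_
    field_simp
    ring
  have h1 := constant_of_has_deriv_right_zero
    (fun s hs => (hP s hs).continuousAt.continuousWithinAt)
    (fun s hs => (hP s (Ico_subset_Icc_self hs)).hasDerivWithinAt) t ht
  have h2 := constant_of_has_deriv_right_zero
    (fun s hs => (hQ s hs).continuousAt.continuousWithinAt)
    (fun s hs => (hQ s (Ico_subset_Icc_self hs)).hasDerivWithinAt) t ht
  simp only [mul_zero, cos_zero, sin_zero, mul_one, sub_zero, zero_add] at h1 h2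
  have hsc := sin_sq_add_cos_sq (ω * t)
  constructor
  · rw [← h1, ← h2]
    linear_combination (-g t) * hsc
  · have h3 : g' 0 = ω * (g' 0 / ω) := by field_simp
    rw [h3, ← h1, ← h2]
    field_simp
    linear_combination (-g' t) * hsc

variable {b : ℝ} {u : ℝ × ℝ → ℝ}

theorem hasDerivAt_slice_fst (hu : Differentiable ℝ u) (x y : ℝ) :
    HasDerivAt (fun t => u (t, y)) (fderiv ℝ u (x, y) (1, 0)) x :=
  (hu (x, y)).hasFDerivAt.comp_hasDerivAt x ((hasDerivAt_id x).prodMk (hasDerivAt_const x y))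

theorem hasDerivAt_slice_snd (hu : Differentiable ℝ u) (x y : ℝ) :
    HasDerivAt (fun t => u (x, t)) (fderiv ℝ u (x, y) (0, 1)) y :=
  (hu (x, y)).hasFDerivAt.comp_hasDerivAt y ((hasDerivAt_const y x).prodMk (hasDerivAt_id y))

theorem contDiff_partial (hu : ContDiff ℝ 2 u) (e : ℝ × ℝ) :
    ContDiff ℝ 1 fun q => fderiv ℝ u q e :=
  (hu.fderiv_right (m := 1) (by norm_num)).clm_apply contDiff_const

theorem continuous_partial (hu : ContDiff ℝ 1 u) (e : ℝ × ℝ) :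
    Continuous fun q => fderiv ℝ u q e :=
  (hu.continuous_fderiv one_ne_zero).clm_apply continuous_const

theorem partial_fst_periodic (hu : Differentiable ℝ u)
    (hper : ∀ p : ℝ × ℝ, u (p.1 + 1, p.2) = u p) (x y : ℝ) :
    fderiv ℝ u (x + 1, y) (1, 0) = fderiv ℝ u (x, y) (1, 0) := by
  have h1 := (hasDerivAt_slice_fst hu (x + 1) y).comp_add_const x 1
  simp only [fun t => hper (t, y)] at h1
  exact h1.unique (hasDerivAt_slice_fst hu x y)

/-- The horizontal mean of an eigenfunction solves the one-dimensional Neumann problem. -/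
theorem hmean_eq (hb : 0 < b) (hu : ContDiff ℝ 2 u)
    (hper : ∀ p : ℝ × ℝ, u (p.1 + 1, p.2) = u p)
    (hlap : ∀ p ∈ stripC b, lapl u p = -((2 * π) ^ 2 * u p))
    (hbc : ∀ x : ℝ, pdy u (x, 0) = 0 ∧ pdy u (x, b) = 0) :
    hmean u 0 * sin (2 * π * b) = 0 ∧
      ∀ y ∈ Icc 0 b, hmean u y = hmean u 0 * cos (2 * π * y) := by
  have hu1 : ContDiff ℝ 1 u := hu.of_le (by norm_num)
  have hud : Differentiable ℝ u := hu.differentiable two_ne_zero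
  have hx := contDiff_partial hu (1, 0)
  have hy := contDiff_partial hu (0, 1)
  have hxx := continuous_partial hx (1, 0)
  have hyy := continuous_partial hy (0, 1)
  set ux : ℝ × ℝ → ℝ := fun q => fderiv ℝ u q (1, 0) with hux
  set uy : ℝ × ℝ → ℝ := fun q => fderiv ℝ u q (0, 1) with huy
  have hd : ∀ y ∈ Icc 0 b, HasDerivAt (hmean u) (hmean uy y) y := fun y _ =>
    hasDerivAt_intervalIntegral_param hu.continuous hy.continuous
      (c := y - 1) (d := y + 1) ⟨by linarith, by linarith⟩
      fun x t _ => hasDerivAt_slice_snd hud x t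
  have hd' : ∀ y ∈ Icc 0 b, HasDerivAt (hmean uy) (-((2 * π) ^ 2 * hmean u y)) y := fun y hyb => by
    have h := hasDerivAt_intervalIntegral_param hy.continuous hyy
      (c := y - 1) (d := y + 1) (y := y) ⟨by linarith, by linarith⟩
      fun x t _ => hasDerivAt_slice_snd (hy.differentiable one_ne_zero) x t
    refine h.congr_deriv ?_
    have e1 : ∀ x, fderiv ℝ uy (x, y) (0, 1) =
        -((2 * π) ^ 2) * u (x, y) - fderiv ℝ ux (x, y) (1, 0) := fun x => by
      have := hlap (x, y) ⟨mem_univ _, hyb⟩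
      simp only [lapl] at this
      linarith
    simp only [e1]
    rw [intervalIntegral.integral_sub
      ((by fun_prop : Continuous fun x => -((2 * π) ^ 2) * u (x, y)).intervalIntegrable _ _)
      ((by fun_prop : Continuous fun x => fderiv ℝ ux (x, y) (1, 0)).intervalIntegrable _ _),
      intervalIntegral.integral_const_mul,
      intervalIntegral.integral_eq_sub_of_hasDerivAt
        (fun x _ => hasDerivAt_slice_fst (hx.differentiable one_ne_zero) x y)
        ((by fun_prop : Continuous fun x => fderiv ℝ ux (x, y) (1, 0)).intervalIntegrable _ _)]
    have := partial_fst_periodic hud hper 0 y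
    simp only [zero_add] at this
    simp only [hux, this, hmean]
    ring
  have h2 : 2 * π ≠ 0 := by positivity
  have hz : hmean uy 0 = 0 := by
    have : ∀ x, uy (x, 0) = 0 := fun x => (hbc x).1
    simp [hmean, this]
  have hzb : hmean uy b = 0 := by
    have : ∀ x, uy (x, b) = 0 := fun x => (hbc x).2
    simp [hmean, this]
  constructor
  · have := (ode_cos_sin h2 hd hd' (right_mem_Icc.2 hb.le)).2
    rw [hz, hzb] at this
    have h3 : 2 * π * (hmean u 0 * sin (2 * π * b)) = 0 := by linarith
    exact (mul_eq_zero.1 h3).resolve_left h2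
  · intro y hy
    have := (ode_cos_sin h2 hd hd' hy).1
    rw [hz] at this
    simpa using this

theorem setIntegral_partial_fst_sq (hb : 0 < b) (hu : ContDiff ℝ 2 u)
    (hper : ∀ p : ℝ × ℝ, u (p.1 + 1, p.2) = u p) :
    ∫ p in rect 1 b, fderiv ℝ u p (1, 0) ^ 2 =
      -∫ p in rect 1 b, u p * fderiv ℝ (fun q => fderiv ℝ u q (1, 0)) p (1, 0) := by
  have hud : Differentiable ℝ u := hu.differentiable two_ne_zero
  have hx := contDiff_partial hu (1, 0)
  have hxx := continuous_partial hx (1, 0)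
  have hc := hx.continuous
  have huc := hu.continuous
  rw [setIntegral_rect_eq hb (by fun_prop), setIntegral_rect_eq hb (by fun_prop),
    ← intervalIntegral.integral_neg]
  refine intervalIntegral.integral_congr fun y _ => ?_
  have h := intervalIntegral.integral_mul_deriv_eq_deriv_mul
    (fun x _ => hasDerivAt_slice_fst hud x y)
    (fun x _ => hasDerivAt_slice_fst (hx.differentiable one_ne_zero) x y)
    ((by fun_prop : Continuous fun x => fderiv ℝ u (x, y) (1, 0)).intervalIntegrable 0 1)
    ((by fun_prop : Continuous fun x =>
      fderiv ℝ (fun q => fderiv ℝ u q (1, 0)) (x, y) (1, 0)).intervalIntegrable 0 1)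
  have h1 := partial_fst_periodic hud hper 0 y
  have h2 := hper (0, y)
  simp only [zero_add] at h1 h2
  simp only [h1, h2, sub_self, zero_sub] at h
  simp only [h, neg_neg, sq]

theorem setIntegral_partial_snd_sq (hb : 0 < b) (hu : ContDiff ℝ 2 u)
    (hbc : ∀ x : ℝ, pdy u (x, 0) = 0 ∧ pdy u (x, b) = 0) :
    ∫ p in rect 1 b, fderiv ℝ u p (0, 1) ^ 2 =
      -∫ p in rect 1 b, u p * fderiv ℝ (fun q => fderiv ℝ u q (0, 1)) p (0, 1) := by
  have hud : Differentiable ℝ u := hu.differentiable two_ne_zero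
  have hy := contDiff_partial hu (0, 1)
  have hyy := continuous_partial hy (0, 1)
  have hc := hy.continuous
  have huc := hu.continuous
  rw [setIntegral_rect_eq' hb (by fun_prop), setIntegral_rect_eq' hb (by fun_prop),
    ← intervalIntegral.integral_neg]
  refine intervalIntegral.integral_congr fun x _ => ?_
  have h := intervalIntegral.integral_mul_deriv_eq_deriv_mul
    (fun y _ => hasDerivAt_slice_snd hud x y)
    (fun y _ => hasDerivAt_slice_snd (hy.differentiable one_ne_zero) x y)
    ((by fun_prop : Continuous fun y => fderiv ℝ u (x, y) (0, 1)).intervalIntegrable 0 b)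
    ((by fun_prop : Continuous fun y =>
      fderiv ℝ (fun q => fderiv ℝ u q (0, 1)) (x, y) (0, 1)).intervalIntegrable 0 b)
  have h1 : fderiv ℝ u (x, 0) (0, 1) = 0 := (hbc x).1
  have h2 : fderiv ℝ u (x, b) (0, 1) = 0 := (hbc x).2
  simp only [h1, h2, mul_zero, sub_self, zero_sub] at h
  simp only [h, neg_neg, sq]

theorem partial_snd_eq_zero (hb : 0 < b) (hu : ContDiff ℝ 2 u)
    (hper : ∀ p : ℝ × ℝ, u (p.1 + 1, p.2) = u p)
    (hlap : ∀ p ∈ stripC b, lapl u p = -((2 * π) ^ 2 * u p))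
    (hbc : ∀ x : ℝ, pdy u (x, 0) = 0 ∧ pdy u (x, b) = 0)
    (hmean0 : ∀ y ∈ Icc 0 b, hmean u y = 0) {p : ℝ × ℝ} (hp : p ∈ Icc (0:ℝ) 1 ×ˢ Icc 0 b) :
    fderiv ℝ u p (0, 1) = 0 := by
  have hud : Differentiable ℝ u := hu.differentiable two_ne_zero
  have hx := contDiff_partial hu (1, 0)
  have hy := contDiff_partial hu (0, 1)
  have hxx := continuous_partial hx (1, 0)
  have hyy := continuous_partial hy (0, 1)
  have huc := hu.continuous
  have hxc := hx.continuous
  have hyc := hy.continuous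
  have h1 := rect_poincare_x hb huc hxc (fun y _ x => hasDerivAt_slice_fst hud x y)
    (fun y _ => by simpa using hper (0, y))
  have h2 : ∫ y in 0..b, hmean u y ^ 2 = 0 := by
    rw [intervalIntegral.integral_congr (g := fun _ => 0) fun y hy => by
      rw [uIcc_of_le hb.le] at hy
      simp [hmean0 y hy]]
    simp
  have h3 : (∫ p in rect 1 b, fderiv ℝ u p (1, 0) ^ 2) + ∫ p in rect 1 b, fderiv ℝ u p (0, 1) ^ 2 =
      (2 * π) ^ 2 * ∫ p in rect 1 b, u p ^ 2 := by
    rw [setIntegral_partial_fst_sq hb hu hper, setIntegral_partial_snd_sq hb hu hbc, ← neg_add,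
      ← integral_add (integrableOn_rect (by fun_prop)) (integrableOn_rect (by fun_prop)),
      ← integral_neg, ← integral_const_mul]
    refine setIntegral_congr_fun measurableSet_rect fun p hp => ?_
    have := hlap p (stripO_subset_stripC (rect_subset_stripO hp))
    simp only [lapl] at this
    simp only [← mul_add, this]
    ring
  have h4 : ∫ p in rect 1 b, fderiv ℝ u p (0, 1) ^ 2 = 0 :=
    le_antisymm (by rw [h2, sub_zero] at h1; linarith) (integral_nonneg fun _ => sq_nonneg _)
  rw [integral_eq_zero_iff_of_nonneg (fun _ => sq_nonneg _)
    (integrableOn_rect (continuous_sq hyc).continuousOn)] at h4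
  have hopen : IsOpen (rect 1 b) := isOpen_Ioo.prod isOpen_Ioo
  have h5 := Measure.eqOn_open_of_ae_eq h4 hopen (continuous_sq hyc).continuousOn continuousOn_const
  have h6 := h5.closure (continuous_sq hyc) continuous_const
  rw [rect, closure_prod_eq, closure_Ioo zero_ne_one, closure_Ioo hb.ne] at h6
  simpa using h6 hp

theorem eq_cos_sin_of_hmean_eq_zero (hb : 0 < b) (hu : ContDiff ℝ 2 u)
    (hper : ∀ p : ℝ × ℝ, u (p.1 + 1, p.2) = u p)
    (hlap : ∀ p ∈ stripC b, lapl u p = -((2 * π) ^ 2 * u p))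
    (hbc : ∀ x : ℝ, pdy u (x, 0) = 0 ∧ pdy u (x, b) = 0)
    (hmean0 : ∀ y ∈ Icc 0 b, hmean u y = 0) :
    ∃ A B : ℝ, ∀ x, ∀ y ∈ Icc 0 b, u (x, y) = A * cos (2 * π * x) + B * sin (2 * π * x) := by
  have hud : Differentiable ℝ u := hu.differentiable two_ne_zero
  have hx := (contDiff_partial hu (1, 0)).differentiable one_ne_zero
  have hy := (contDiff_partial hu (0, 1)).differentiable one_ne_zero
  have hz : ∀ x ∈ Icc (0:ℝ) 1, ∀ y ∈ Icc 0 b, fderiv ℝ u (x, y) (0, 1) = 0 := fun x hx y hy =>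
    partial_snd_eq_zero hb hu hper hlap hbc hmean0 ⟨hx, hy⟩
  have hconst : ∀ x ∈ Icc (0:ℝ) 1, ∀ y ∈ Icc 0 b, u (x, y) = u (x, 0) := fun x hx y hy =>
    constant_of_has_deriv_right_zero (f := fun t => u (x, t))
      (hu.continuous.comp (by fun_prop : Continuous fun t : ℝ => (x, t))).continuousOn
      (fun t ht => (hz x hx t (Ico_subset_Icc_self ht) ▸
        hasDerivAt_slice_snd hud x t).hasDerivWithinAt) y hy
  have hmid : b / 2 ∈ Icc 0 b := ⟨by linarith, by linarith⟩
  have hode : ∀ x ∈ Icc (0:ℝ) 1,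
      HasDerivAt (fun t => fderiv ℝ u (t, b / 2) (1, 0)) (-((2 * π) ^ 2 * u (x, b / 2))) x := by
    intro x hx1
    refine (hasDerivAt_slice_fst hx x (b / 2)).congr_deriv ?_
    have h1 := hlap (x, b / 2) ⟨mem_univ _, hmid⟩
    have h2 : HasDerivAt (fun t => fderiv ℝ u (x, t) (0, 1)) 0 (b / 2) :=
      (hasDerivAt_const (b / 2) (0:ℝ)).congr_of_eventuallyEq
        (eventuallyEq_of_mem (Icc_mem_nhds (by linarith) (by linarith)) fun t ht => hz x hx1 t ht)
    have h3 := (hasDerivAt_slice_snd hy x (b / 2)).unique h2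
    simp only [lapl, h3, add_zero] at h1
    exact h1
  refine ⟨u (0, b / 2), fderiv ℝ u (0, b / 2) (1, 0) / (2 * π), fun x y hyb => ?_⟩
  have hpu : Function.Periodic (fun t => u (t, y) - (u (0, b / 2) * cos (2 * π * t) +
      fderiv ℝ u (0, b / 2) (1, 0) / (2 * π) * sin (2 * π * t))) 1 := fun t => by
    simp [hper (t, y), mul_add, sin_add_two_pi, cos_add_two_pi]
  obtain ⟨t, ht, he⟩ := hpu.exists_mem_Ico₀ one_pos x
  refine sub_eq_zero.1 (he.trans (sub_eq_zero.2 ?_))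
  have ht' := Ico_subset_Icc_self ht
  rw [hconst t ht' y hyb, ← hconst t ht' _ hmid]
  exact (ode_cos_sin (by positivity) (fun s _ => hasDerivAt_slice_fst hud s (b / 2)) hode ht').1

theorem eq_cos_sin_of_isNeumannEigenfun (hb : 0 < b) (hu : IsNeumannEigenfun 1 b ((2 * π) ^ 2) u) :
    ∃ A B C : ℝ, C * sin (2 * π * b) = 0 ∧ ∀ x, ∀ y ∈ Icc 0 b,
      u (x, y) = A * cos (2 * π * x) + B * sin (2 * π * x) + C * cos (2 * π * y) := by
  obtain ⟨hper, hc, -, hlap, hbc⟩ := hu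
  obtain ⟨hC, hcos⟩ := hmean_eq hb hc hper hlap hbc
  set C := hmean u 0
  let w : ℝ × ℝ → ℝ := fun p => C * cos (2 * π * p.2)
  have hw : ContDiff ℝ 2 w := by fun_prop
  have hud : Differentiable ℝ u := hc.differentiable two_ne_zero
  have hwd : Differentiable ℝ w := hw.differentiable two_ne_zero
  have hw1 := fun q : ℝ × ℝ =>
    fderiv_comp_snd (p := q) ((hasDerivAt_cos_mul (2 * π) q.2).const_mul C)
  have hw2 := fun q : ℝ × ℝ => (fderiv_comp_snd (h := fun y => C * -(2 * π * sin (2 * π * y)))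
    (p := q) (((hasDerivAt_sin_mul (2 * π) q.2).const_mul (2 * π)).neg.const_mul C)).2
  have hsub : ∀ e : ℝ × ℝ, (fun q => fderiv ℝ (fun p => u p - w p) q e) =
      fun q => fderiv ℝ u q e - fderiv ℝ w q e := fun e => by
    funext q
    rw [fderiv_fun_sub (hud q) (hwd q)]
    rfl
  have hpd : ∀ p e, fderiv ℝ (fun q => fderiv ℝ (fun p => u p - w p) q e) p e =
      fderiv ℝ (fun q => fderiv ℝ u q e) p e - fderiv ℝ (fun q => fderiv ℝ w q e) p e :=
    fun p e => by
      rw [hsub, fderiv_fun_sub ((contDiff_partial hc e).differentiable one_ne_zero p)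
        ((contDiff_partial hw e).differentiable one_ne_zero p)]
      rfl
  have hlw : ∀ p, lapl w p = -((2 * π) ^ 2 * w p) := fun p => by
    simp only [lapl, w, (hw1 _).1, (hw1 _).2, hw2, fderiv_fun_const]
    simp
    ring
  have hv : ∃ A B : ℝ, ∀ x, ∀ y ∈ Icc 0 b,
      u (x, y) - w (x, y) = A * cos (2 * π * x) + B * sin (2 * π * x) := by
    refine eq_cos_sin_of_hmean_eq_zero (u := fun p => u p - w p) hb (hc.sub hw)
      (fun p => by simp [hper p, w]) (fun p hp => ?_) (fun x => ?_) (fun y hy => ?_)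
    · have h1 := hlap p hp
      have h2 := hlw p
      simp only [lapl] at h1 h2 ⊢
      rw [hpd, hpd]
      linarith
    · have h1 := fun p => congrFun (hsub (0, 1)) p
      have h2 := hbc x
      simp only [pdy] at h2 ⊢
      simp only [h1, h2.1, h2.2, w, (hw1 _).2]
      refine ⟨by simp, ?_⟩
      linear_combination (2 * π) * hC
    · have h1 := hcos y hy
      have huc := hc.continuous
      simp only [hmean, w] at h1 ⊢
      rw [intervalIntegral.integral_sub
        ((by fun_prop : Continuous fun x => u (x, y)).intervalIntegrable _ _)
        intervalIntegrable_const, h1]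
      simp
  obtain ⟨A, B, hAB⟩ := hv
  refine ⟨A, B, C, hC, fun x y hy => ?_⟩
  rw [← hAB x y hy]
  simp [w]

end Classification

section NodalCount

theorem card_connectedComponents_le_two {X : Type*} [TopologicalSpace X] {s t : Set X}
    (hs : IsPreconnected s) (ht : IsPreconnected t) (h : s ∪ t = univ) :
    Nat.card (ConnectedComponents X) ≤ 2 := by
  classical
  have hsurj := ConnectedComponents.surjective_coe (α := X)
  let r := Function.surjInv hsurj
  have hr : ∀ c, ConnectedComponents.mk (r c) = c := Function.surjInv_eq hsurj
  have key : ∀ {v : Set X}, IsPreconnected v → ∀ c d, r c ∈ v → r d ∈ v → c = d :=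
    fun hv c d hc hd => by
      rw [← hr c, ← hr d]
      exact ConnectedComponents.coe_eq_coe'.2 (hv.subset_connectedComponent hd hc)
  have hst : ∀ c, r c ∉ s → r c ∈ t := fun c hc =>
    (show r c ∈ s ∪ t from h ▸ mem_univ _).resolve_left hc
  have hinj : Function.Injective fun c => decide (r c ∈ s) := fun c d hcd => by
    by_cases hc : r c ∈ s
    · exact key hs c d hc (by simpa [hc] using hcd)
    · exact key ht c d (hst c hc) (hst d (by simpa [hc] using hcd))
  simpa using Nat.card_le_card_of_injective _ hinj

theorem ordConnected_setOf_pos {b C : ℝ} (R : ℝ) (hC : C = 0 ∨ b ≤ 1 / 2) :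
    OrdConnected {y | y ∈ Ioo 0 b ∧ 0 < R + C * cos (2 * π * y)} := by
  refine ⟨fun y₁ h₁ y₂ h₂ y hy => ⟨⟨h₁.1.1.trans_le hy.1, hy.2.trans_lt h₂.1.2⟩, ?_⟩⟩
  obtain ⟨⟨h1, -⟩, p1⟩ := h₁
  obtain ⟨⟨-, h2⟩, p2⟩ := h₂
  rcases hC with rfl | hC
  · simpa using p1
  have hpi := pi_pos
  have c1 : cos (2 * π * y) ≤ cos (2 * π * y₁) :=
    cos_le_cos_of_nonneg_of_le_pi (by positivity) (by nlinarith [hy.2])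
      (by nlinarith [hy.1])
  have c2 : cos (2 * π * y₂) ≤ cos (2 * π * y) :=
    cos_le_cos_of_nonneg_of_le_pi (by nlinarith [hy.1]) (by nlinarith)
      (by nlinarith [hy.2])
  rcases le_total 0 C with h | h
  · linarith [mul_le_mul_of_nonneg_left c2 h]
  · linarith [mul_le_mul_of_nonpos_left c1 h]

theorem exists_polar (A B : ℝ) : ∃ R x₀ : ℝ, 0 ≤ R ∧
    ∀ x, A * cos (2 * π * x) + B * sin (2 * π * x) = R * cos (2 * π * (x - x₀)) := by
  refine ⟨‖(⟨A, B⟩ : ℂ)‖, Complex.arg ⟨A, B⟩ / (2 * π), norm_nonneg _, fun x => ?_⟩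
  have h1 := Complex.norm_mul_cos_arg ⟨A, B⟩
  have h2 := Complex.norm_mul_sin_arg ⟨A, B⟩
  have h3 : 2 * π * (x - Complex.arg ⟨A, B⟩ / (2 * π)) = 2 * π * x - Complex.arg ⟨A, B⟩ := by
    field_simp
  simp only at h1 h2
  rw [h3, cos_sub]
  linear_combination (-cos (2 * π * x)) * h1 - sin (2 * π * x) * h2

variable {b : ℝ} {u : ℝ × ℝ → ℝ}

theorem isPreconnected_image_setOf_pos {A B C : ℝ} (hC : C = 0 ∨ b ≤ 1 / 2)
    (hu : ∀ x, ∀ y ∈ Icc 0 b,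
      u (x, y) = A * cos (2 * π * x) + B * sin (2 * π * x) + C * cos (2 * π * y)) :
    IsPreconnected (projCyl 1 '' {p | p ∈ stripO b ∧ 0 < u p}) := by
  obtain ⟨R, x₀, hR, hAB⟩ := exists_polar A B
  let W : Set (ℝ × ℝ) := {p | |p.1 - x₀| ≤ 1 / 2 ∧ p.2 ∈ Ioo 0 b ∧
    0 < R * cos (2 * π * (p.1 - x₀)) + C * cos (2 * π * p.2)}
  have hW : projCyl 1 '' {p | p ∈ stripO b ∧ 0 < u p} = projCyl 1 '' W := by
    refine Subset.antisymm ?_ ?_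
    · rintro _ ⟨⟨x, y⟩, ⟨⟨-, hy⟩, hpos⟩, rfl⟩
      rw [hu x y (Ioo_subset_Icc_self hy), hAB] at hpos
      refine ⟨(x - round (x - x₀), y), ⟨?_, hy, ?_⟩, ?_⟩
      · simpa [sub_right_comm] using abs_sub_round (x - x₀)
      · have h : 2 * π * (x - round (x - x₀) - x₀) =
            2 * π * (x - x₀) - round (x - x₀) * (2 * π) := by ring
        simpa only [h, cos_sub_int_mul_two_pi] using hpos
      · refine Prod.ext ?_ rfl
        simp [projCyl]
    · refine image_mono ?_
      rintro ⟨x, y⟩ ⟨-, hy, hpos⟩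
      refine ⟨⟨mem_univ _, hy⟩, ?_⟩
      rwa [hu x y (Ioo_subset_Icc_self hy), hAB]
  rw [hW]
  have hproj : Continuous (projCyl 1) :=
    ((AddCircle.continuous_mk' 1).comp continuous_fst).prodMk continuous_snd
  refine IsPreconnected.image (isPreconnected_of_forall_pair fun p hp q hq => ?_) _
    hproj.continuousOn
  have hhor : ∀ p ∈ W, (fun s => (s, p.2)) '' uIcc p.1 x₀ ⊆ W := by
    rintro ⟨x, y⟩ ⟨hx, hy, hpos⟩ _ ⟨s, hs, rfl⟩
    have hs1 : |s - x₀| ≤ |x - x₀| := by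
      simpa only [abs_sub_comm] using abs_sub_right_of_mem_uIcc hs
    refine ⟨hs1.trans hx, hy, hpos.trans_le ?_⟩
    have hcos : cos (2 * π * (x - x₀)) ≤ cos (2 * π * (s - x₀)) := by
      have habs : ∀ t : ℝ, cos (2 * π * t) = cos (2 * π * |t|) := fun t => by
        rw [← cos_abs, abs_mul, abs_of_pos two_pi_pos]
      rw [habs (x - x₀), habs (s - x₀)]
      have hpi := pi_pos
      exact cos_le_cos_of_nonneg_of_le_pi (by positivity) (by simp only at hx; nlinarith)
        (by gcongr)
    simp only
    gcongr
  have hmid : ∀ p ∈ W, p.2 ∈ {y | y ∈ Ioo 0 b ∧ 0 < R + C * cos (2 * π * y)} := fun p hp =>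
    ⟨hp.2.1, hp.2.2.trans_le (by
      gcongr
      exact mul_le_of_le_one_right hR (cos_le_one _))⟩
  have hver : (fun t => (x₀, t)) '' uIcc p.2 q.2 ⊆ W := by
    rintro _ ⟨t, ht, rfl⟩
    have := (ordConnected_setOf_pos R hC).uIcc_subset (hmid p hp) (hmid q hq) ht
    exact ⟨by simp, this.1, by simpa using this.2⟩
  have hph : ∀ y x : ℝ, IsPreconnected ((fun s : ℝ => (s, y)) '' uIcc x x₀) := fun y x =>
    isPreconnected_uIcc.image _ (by fun_prop)
  have hpv : IsPreconnected ((fun t : ℝ => (x₀, t)) '' uIcc p.2 q.2) :=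
    isPreconnected_uIcc.image _ (by fun_prop)
  let H : ℝ × ℝ → Set (ℝ × ℝ) := fun p => (fun s => (s, p.2)) '' uIcc p.1 x₀
  let V : Set (ℝ × ℝ) := (fun t => (x₀, t)) '' uIcc p.2 q.2
  have h1 : IsPreconnected (H p ∪ V) := IsPreconnected.union (x₀, p.2) ⟨x₀, right_mem_uIcc, rfl⟩
    ⟨p.2, left_mem_uIcc, rfl⟩ (hph p.2 p.1) hpv
  have h2 : IsPreconnected (H p ∪ V ∪ H q) :=
    IsPreconnected.union (x₀, q.2) (Or.inr ⟨q.2, right_mem_uIcc, rfl⟩)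
    ⟨x₀, right_mem_uIcc, rfl⟩ h1 (hph q.2 q.1)
  exact ⟨H p ∪ V ∪ H q, union_subset (union_subset (hhor p hp) hver) (hhor q hq),
    Or.inl (Or.inl ⟨p.1, left_mem_uIcc, rfl⟩), Or.inr ⟨q.1, left_mem_uIcc, rfl⟩, h2⟩

theorem nodalCount_le_two {A B C : ℝ} (hC : C = 0 ∨ b ≤ 1 / 2)
    (hu : ∀ x, ∀ y ∈ Icc 0 b,
      u (x, y) = A * cos (2 * π * x) + B * sin (2 * π * x) + C * cos (2 * π * y)) :
    nodalCount 1 b u ≤ 2 := by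
  have hpos := isPreconnected_image_setOf_pos hC hu
  have hneg := isPreconnected_image_setOf_pos (u := fun p => -u p) (A := -A) (B := -B) (C := -C)
    (by simpa using hC) fun x y hy => by rw [hu x y hy]; ring
  have hunion : nonzeroSet 1 b u = projCyl 1 '' {p | p ∈ stripO b ∧ 0 < u p} ∪
      projCyl 1 '' {p | p ∈ stripO b ∧ 0 < -u p} := by
    rw [nonzeroSet, ← image_union]
    congr 1
    ext p
    simp only [mem_union, mem_ofPred_eq, neg_pos, ← and_or_left, ne_iff_lt_or_gt,
      or_comm (a := u p < 0)]
  have hsub : ∀ {s : Set (AddCircle (1:ℝ) × ℝ)}, s ⊆ nonzeroSet 1 b u → IsPreconnected s →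
      IsPreconnected ((↑) ⁻¹' s : Set (nonzeroSet 1 b u)) := fun hs h => by
    refine Topology.IsInducing.subtypeVal.isPreconnected_image.1 ?_
    rwa [Subtype.image_preimage_coe, inter_eq_right.2 hs]
  refine card_connectedComponents_le_two (hsub (hunion ▸ subset_union_left) hpos)
    (hsub (hunion ▸ subset_union_right) hneg) (eq_univ_of_forall fun q => ?_)
  rw [← preimage_union, ← hunion]
  exact q.2

end NodalCount

/-- The third Neumann eigenvalue of the cylindrical strip `C(b)` is
Courant sharp if and only if `b ≥ 1`. -/
theorem courantSharp_third_iff (b : ℝ) (hb : 0 < b) :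
    CourantSharpN 1 b 3 ↔ 1 ≤ b := by
  constructor
  · rintro ⟨u, hu, hcard⟩
    by_contra! hb1
    rw [lamN_three_of_le_one hb hb1.le] at hu
    obtain ⟨A, B, C, hC, hform⟩ := eq_cos_sin_of_isNeumannEigenfun hb hu
    have hC' : C = 0 ∨ b ≤ 1 / 2 := (mul_eq_zero.1 hC).imp_right fun h => by
      by_contra! hb2
      have hpi := pi_pos
      have : sin (2 * π * b - π) > 0 := sin_pos_of_pos_of_lt_pi (by nlinarith) (by nlinarith)
      rw [sin_sub_pi] at this
      linarith
    have := nodalCount_le_two hC' hform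
    omega
  · intro hb1
    exact ⟨_, lamN_three_of_one_le hb1 ▸ isNeumannEigenfun_cos hb, nodalCount_cos hb⟩
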